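/- arXiv:2505.12855 — 3 statements merged into one kernel-verified Lean document; each statement's English description precedes it below -/
import Mathlib

section
/- Let D be a division ring that is finite-dimensional over its center F, and let f(x_1,…,x_n) be a multilinear polynomial over F that is non-central over the matrix ring M_2(F). Then there exist elements c_1,…,c_n ∈ D such that F(f(c_1,…,c_n)) is a maximal subfield of D. -/
/-- Evaluation of the multilinear polynomial
`f(x_1,…,x_n) = ∑_{σ ∈ S_n} c σ • x_{σ(1)} x_{σ(2)} ⋯ x_{σ(n)}`
(given by its coefficient family `c`) at the tuple `T` in an `F`-algebra `R`. -/
def mlEval {F : Type*} [CommSemiring F] {n : ℕ} (c : Equiv.Perm (Fin n) → F)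
    {R : Type*} [Ring R] [Algebra F R] (T : Fin n → R) : R :=
  ∑ σ : Equiv.Perm (Fin n), c σ • (List.ofFn fun i => T (σ i)).prod

/-- A subfield (in the sense of Mathlib: a division subring) `K` of a division ring `D`
is a maximal subfield if it is commutative and is not properly contained in any
commutative subfield of `D`. -/
def IsMaximalSubfield {D : Type*} [DivisionRing D] (K : Subfield D) : Prop :=
  (∀ x ∈ K, ∀ y ∈ K, x * y = y * x) ∧
    ∀ L : Subfield D, (∀ x ∈ L, ∀ y ∈ L, x * y = y * x) → K ≤ L → K = L

open TensorProduct in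
theorem simple_tensor {F D K : Type*} [Field F] [DivisionRing D] [Algebra F D]
    [Field K] [Algebra F K]
    (hcenter : Set.range (algebraMap F D) = Set.center D) : IsSimpleRing (D ⊗[F] K) := by
  classical
  rw [isSimpleRing_iff_isTwoSided_imp]
  refine ⟨inferInstance, fun I hI => ?_⟩
  by_contra! hcon
  obtain ⟨hbot, htop⟩ := hcon
  let b := Module.Free.chooseBasis F K
  let B := Algebra.TensorProduct.basis D b
  have hr : ∀ (x : D ⊗[F] K) (d : D) i, B.repr (x * (d ⊗ₜ 1)) i = B.repr x i * d := by
    intro x d i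
    induction x using TensorProduct.induction_on with
    | zero => simp
    | add x y hx hy => simp [add_mul, hx, hy]
    | tmul a k =>
      simp only [Algebra.TensorProduct.tmul_mul_tmul, mul_one, B,
        Algebra.TensorProduct.basis_repr_tmul, Finsupp.smul_apply, Finsupp.mapRange_apply,
        smul_eq_mul, mul_assoc, Algebra.commutes]
  have hl : ∀ (x : D ⊗[F] K) (d : D) i, B.repr ((d ⊗ₜ 1) * x) i = d * B.repr x i := by
    intro x d i
    have : (d ⊗ₜ[F] (1:K)) * x = d • x := by
      induction x using TensorProduct.induction_on with
      | zero => simp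
      | add x y hx hy => simp [mul_add, hx, hy]
      | tmul a k => simp [TensorProduct.smul_tmul']
    rw [this]; simp
  have hex : ∃ m : ℕ, ∃ x ∈ I, x ≠ 0 ∧ (B.repr x).support.card = m := by
    obtain ⟨x, hx, hx0⟩ := Submodule.exists_mem_ne_zero_of_ne_bot hbot
    exact ⟨_, x, hx, hx0, rfl⟩
  obtain ⟨x, hxI, hx0, hxm⟩ := Nat.find_spec hex
  have hmin : ∀ y ∈ I, (B.repr y).support.card < (B.repr x).support.card → y = 0 := by
    intro y hy hlt
    by_contra hy0
    rw [hxm] at hlt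
    exact Nat.find_min hex hlt ⟨y, hy, hy0, rfl⟩
  have hsupp : (B.repr x).support.Nonempty := by
    rw [Finsupp.support_nonempty_iff]
    simpa using hx0
  obtain ⟨i0, hi0⟩ := hsupp
  have hd0 : B.repr x i0 ≠ 0 := by simpa using hi0
  set d0 := B.repr x i0 with hd0def
  let x' := (d0⁻¹ ⊗ₜ[F] (1:K)) * x
  have hx'I : x' ∈ I := I.mul_mem_left _ hxI
  have hcen : ∀ i, B.repr x' i ∈ Set.center D := by
    intro i
    rw [Semigroup.mem_center_iff]
    intro d
    have hy : (d ⊗ₜ[F] (1:K)) * x' - x' * (d ⊗ₜ[F] (1:K)) = 0 := by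
      apply hmin
      · exact I.sub_mem (I.mul_mem_left _ hx'I) (I.mul_mem_right _ hx'I)
      · apply Finset.card_lt_card
        rw [Finset.ssubset_iff_of_subset]
        · refine ⟨i0, hi0, ?_⟩
          simp [hl, hr, x', ← hd0def, hd0]
        · intro j hj
          simp only [Finsupp.mem_support_iff, map_sub, Finsupp.sub_apply, hl, hr, x'] at hj ⊢
          intro h0
          simp [h0] at hj
    have := congrArg (fun z => B.repr z i) hy
    simp only [map_sub, Finsupp.sub_apply, hl, hr, map_zero, Finsupp.coe_zero, Pi.zero_apply] at this
    exact sub_eq_zero.mp this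
  rw [← hcenter] at hcen
  choose s hs using hcen
  have hx'0 : x' ≠ 0 := by
    intro h
    have := hl x d0⁻¹ i0
    rw [← hd0def, inv_mul_cancel₀ hd0] at this
    change B.repr x' i0 = 1 at this
    rw [h] at this
    simp at this
  have hk : ∃ k : K, x' = 1 ⊗ₜ[F] k := by
    refine ⟨∑ i ∈ (B.repr x').support, s i • b i, ?_⟩
    conv_lhs => rw [← B.linearCombination_repr x']
    rw [Finsupp.linearCombination_apply, Finsupp.sum, TensorProduct.tmul_sum]
    refine Finset.sum_congr rfl fun i _ => ?_
    rw [← hs i, Algebra.TensorProduct.basis_apply, TensorProduct.smul_tmul', TensorProduct.tmul_smul,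
      TensorProduct.smul_tmul', smul_eq_mul, mul_one, Algebra.smul_def, mul_one]
  obtain ⟨k, hk⟩ := hk
  have hk0 : k ≠ 0 := by rintro rfl; simp at hk; exact hx'0 hk
  apply htop
  rw [Ideal.eq_top_iff_one]
  have := I.mul_mem_left ((1:D) ⊗ₜ[F] k⁻¹) hx'I
  rw [hk] at this
  simpa [inv_mul_cancel₀ hk0, ← Algebra.TensorProduct.one_def] using this

open TensorProduct in
theorem exists_splitting {F D : Type*} (K : Type*) [Field F] [DivisionRing D] [Algebra F D]
    [FiniteDimensional F D] [Field K] [Algebra F K] [IsAlgClosed K]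
    (hcenter : Set.range (algebraMap F D) = Set.center D) :
    ∃ (d : ℕ) (e : D →ₐ[F] Matrix (Fin d) (Fin d) K),
      ∀ {N : ℕ} (b : Module.Basis (Fin N) F D), ∃ B : Module.Basis (Fin N) K (Matrix (Fin d) (Fin d) K),
        ∀ i, B i = e (b i) := by
  have h1 : IsSimpleRing (D ⊗[F] K) := simple_tensor hcenter
  have h2 : IsSimpleRing (K ⊗[F] D) :=
    IsSimpleRing.of_ringEquiv (Algebra.TensorProduct.comm F D K).toRingEquiv h1
  obtain ⟨d, _, ⟨E⟩⟩ := IsSimpleRing.exists_algEquiv_matrix_of_isAlgClosed K (K ⊗[F] D)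
  refine ⟨d, (E.toAlgHom.restrictScalars F).comp Algebra.TensorProduct.includeRight, ?_⟩
  intro N b
  refine ⟨(Algebra.TensorProduct.basis K b).map E.toLinearEquiv, fun i => ?_⟩
  simp

theorem mlEval_map {F : Type*} [CommSemiring F] {n : ℕ} (c : Equiv.Perm (Fin n) → F)
    {R S : Type*} [Ring R] [Algebra F R] [Ring S] [Algebra F S] (φ : R →ₐ[F] S) (T : Fin n → R) :
    φ (mlEval c T) = mlEval c (fun i => φ (T i)) := by
  simp only [mlEval, map_sum, map_smul, map_list_prod, List.map_ofFn, Function.comp_def]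

theorem mlEval_smul {F K : Type*} [CommSemiring F] [CommSemiring K] {n : ℕ}
    (c : Equiv.Perm (Fin n) → F)
    {R : Type*} [Ring R] [Algebra F R] [Algebra K R] [SMulCommClass F K R] (t : K)
    (T : Fin n → R) :
    mlEval c (fun i => t • T i) = t ^ n • mlEval c T := by
  simp only [mlEval, Finset.smul_sum]
  refine Finset.sum_congr rfl fun σ _ => ?_
  have := (MultilinearMap.mkPiAlgebraFin K n R).map_smul_univ (fun _ => t) (fun i => T (σ i))
  simp only [MultilinearMap.mkPiAlgebraFin_apply, Finset.prod_const, Finset.card_univ,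
    Fintype.card_fin] at this
  rw [this, smul_comm]

theorem mlEval_zero {F : Type*} [CommSemiring F] {n : ℕ} (hn : n ≠ 0)
    (c : Equiv.Perm (Fin n) → F)
    {R : Type*} [Ring R] [Algebra F R] :
    mlEval c (fun _ => (0 : R)) = 0 := by
  have := mlEval_smul (K := F) (R := R) c 0 (fun _ => 0)
  simpa [hn] using this

theorem mlEval_intertwine {F K : Type*} [Field F] [Field K] [Algebra F K] {n : ℕ}
    (c : Equiv.Perm (Fin n) → F) {V W : Type*} [AddCommGroup V] [Module K V] [AddCommGroup W]
    [Module K W] [Module F V] [IsScalarTower F K V] [Module F W] [IsScalarTower F K W]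
    (π : V →ₗ[K] W) (T : Fin n → Module.End K V)
    (S : Fin n → Module.End K W) (h : ∀ k v, π (T k v) = S k (π v)) (v : V) :
    π (mlEval c T v) = mlEval c S (π v) := by
  simp only [mlEval, LinearMap.sum_apply, map_sum, LinearMap.smul_apply]
  refine Finset.sum_congr rfl fun σ _ => ?_
  rw [← algebraMap_smul K (c σ), map_smul, algebraMap_smul]
  congr 1
  have key : ∀ (l : List (Fin n)) (v : V),
      π ((l.map T).prod v) = (l.map S).prod (π v) := by
    intro l
    induction l with
    | nil => simp
    | cons a l ih => intro v; simp [h, ih]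
  have e1 : (List.ofFn fun i => T (σ i)) = (List.ofFn σ).map T := by
    rw [List.map_ofFn]; rfl
  have e2 : (List.ofFn fun i => S (σ i)) = (List.ofFn σ).map S := by
    rw [List.map_ofFn]; rfl
  rw [e1, e2, key]

/-- The multilinear map attached to a multilinear polynomial. -/
noncomputable def mlMap {F : Type*} [CommSemiring F] {n : ℕ} (c : Equiv.Perm (Fin n) → F)
    (R : Type*) [Ring R] [Algebra F R] : MultilinearMap F (fun _ : Fin n => R) R :=
  ∑ σ : Equiv.Perm (Fin n), c σ • (MultilinearMap.mkPiAlgebraFin F n R).domDomCongr σ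

theorem mlMap_apply {F : Type*} [CommSemiring F] {n : ℕ} (c : Equiv.Perm (Fin n) → F)
    {R : Type*} [Ring R] [Algebra F R] (T : Fin n → R) : mlMap c R T = mlEval c T := by
  simp [mlMap, mlEval]

/-- Homogeneity for the `ℤ/2`-grading on `2 × 2` matrices. -/
def IsHomog2 {F : Type*} [CommRing F] (b : Fin 2) (M : Matrix (Fin 2) (Fin 2) F) : Prop :=
  ∀ i j, M i j ≠ 0 → i + j = b

theorem IsHomog2.mul {F : Type*} [CommRing F] {a b : Fin 2} {M N : Matrix (Fin 2) (Fin 2) F}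
    (hM : IsHomog2 a M) (hN : IsHomog2 b N) : IsHomog2 (a + b) (M * N) := by
  intro i k h
  rw [Matrix.mul_apply] at h
  obtain ⟨j, _, hj⟩ := Finset.exists_ne_zero_of_sum_ne_zero h
  have h1 := hM i j (left_ne_zero_of_mul hj)
  have h2 := hN j k (right_ne_zero_of_mul hj)
  rw [← h1, ← h2]
  have : ∀ i j k : Fin 2, i + k = i + j + (j + k) := by decide
  exact this i j k

theorem IsHomog2.mlEval {F A : Type*} [CommRing F] [CommRing A] [Algebra F A] {n : ℕ}
    (c : Equiv.Perm (Fin n) → F)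
    (T : Fin n → Matrix (Fin 2) (Fin 2) A) (b : Fin n → Fin 2) (h : ∀ k, IsHomog2 (b k) (T k)) :
    IsHomog2 (∑ k, b k) (mlEval c T) := by
  have key : ∀ l : List (Fin n), IsHomog2 (l.map b).sum (l.map T).prod := by
    intro l
    induction l with
    | nil =>
      intro i j hij
      simp only [List.map_nil, List.prod_nil, Matrix.one_apply, ne_eq, ite_eq_right_iff,
        not_forall] at hij
      obtain ⟨rfl, _⟩ := hij
      simp only [List.map_nil, List.sum_nil]
      revert i; decide
    | cons a l ih => simpa using (h a).mul ih
  intro i j hij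
  rw [_root_.mlEval, Matrix.sum_apply] at hij
  obtain ⟨σ, _, hσ⟩ := Finset.exists_ne_zero_of_sum_ne_zero hij
  have e1 : (List.ofFn fun i => T (σ i)) = (List.ofFn σ).map T := by
    rw [List.map_ofFn]; rfl
  have e2 : ((List.ofFn σ).map b).sum = ∑ k, b k := by
    rw [List.map_ofFn, List.sum_ofFn]
    exact Equiv.sum_comp σ b
  rw [← e2]
  apply key
  rw [← e1]
  intro h0
  rw [Matrix.smul_apply, h0, smul_zero] at hσ
  exact hσ rfl

theorem mlEval_conj {F : Type*} [Field F] {n : ℕ} (c : Equiv.Perm (Fin n) → F)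
    {R : Type*} [Ring R] [Algebra F R] (g : Rˣ) (T : Fin n → R) :
    mlEval c (fun i => g * T i * ↑g⁻¹) = g * mlEval c T * ↑g⁻¹ := by
  simp only [mlEval, Finset.mul_sum, Finset.sum_mul]
  refine Finset.sum_congr rfl fun σ _ => ?_
  rw [mul_smul_comm, smul_mul_assoc]
  congr 1
  have key : ∀ l : List R, (l.map fun x => (g:R) * x * ↑g⁻¹).prod = g * l.prod * ↑g⁻¹ := by
    intro l
    induction l with
    | nil => simp
    | cons a l ih => rw [List.map_cons, List.prod_cons, ih, List.prod_cons]; simp [mul_assoc]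
  rw [← key, List.map_ofFn]; rfl

theorem exists_basis_tuple {F : Type*} [Field F] {n : ℕ} (c : Equiv.Perm (Fin n) → F)
    (hf : ¬ ∀ T : Fin n → Matrix (Fin 2) (Fin 2) F, ∃ a : F,
      mlEval c T = a • (1 : Matrix (Fin 2) (Fin 2) F)) :
    ∃ u : Fin n → Fin 2 × Fin 2,
      mlEval c (fun k => Matrix.single (u k).1 (u k).2 (1 : F)) 0 1 ≠ 0 := by
  by_contra! hcon
  apply hf
  let P : MultilinearMap F (fun _ : Fin n => Matrix (Fin 2) (Fin 2) F) F :=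
    (Matrix.entryLinearMap F F (0 : Fin 2) (1 : Fin 2)).compMultilinearMap
      (mlMap c (Matrix (Fin 2) (Fin 2) F))
  have hP : P = 0 := by
    refine Module.Basis.ext_multilinear
      (fun _ => Matrix.stdBasis F (Fin 2) (Fin 2)) (fun v => ?_)
    simp only [P, LinearMap.compMultilinearMap_apply, mlMap_apply,
      Matrix.entryLinearMap_apply, zero_apply]
    have hv : (fun i => Matrix.stdBasis F (Fin 2) (Fin 2) (v i)) =
        fun k => Matrix.single (v k).1 (v k).2 (1 : F) := by
      funext k
      exact Matrix.stdBasis_eq_single F (v k).1 (v k).2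
    rw [hv]
    exact hcon v
  have h01 : ∀ T : Fin n → Matrix (Fin 2) (Fin 2) F, mlEval c T 0 1 = 0 := by
    intro T
    have := congrArg (fun Q => Q T) hP
    simpa [P, mlMap_apply] using this
  have h10 : ∀ T : Fin n → Matrix (Fin 2) (Fin 2) F, mlEval c T 1 0 = 0 := by
    intro T
    let φ := Matrix.reindexAlgEquiv F F (Equiv.swap (0 : Fin 2) 1)
    have h1 := h01 (fun i => φ (T i))
    have h2 := mlEval_map c (φ : Matrix (Fin 2) (Fin 2) F →ₐ[F] Matrix (Fin 2) (Fin 2) F) T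
    simp only [AlgEquiv.coe_toAlgHom] at h2
    rw [← h2] at h1
    simpa [φ] using h1
  intro T
  let g : (Matrix (Fin 2) (Fin 2) F)ˣ :=
    ⟨!![1, 1; 0, 1], !![1, -1; 0, 1], by ext i j; fin_cases i <;> fin_cases j <;> simp,
      by ext i j; fin_cases i <;> fin_cases j <;> simp⟩
  have h3 := h01 (fun i => (g : Matrix (Fin 2) (Fin 2) F) * T i *
    ((g⁻¹ : (Matrix (Fin 2) (Fin 2) F)ˣ) : Matrix (Fin 2) (Fin 2) F))
  rw [mlEval_conj] at h3
  have hg : (g : Matrix (Fin 2) (Fin 2) F) = !![1, 1; 0, 1] := rfl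
  have hg' : ((g⁻¹ : (Matrix (Fin 2) (Fin 2) F)ˣ) : Matrix (Fin 2) (Fin 2) F) = !![1, -1; 0, 1] := rfl
  rw [hg, hg'] at h3
  simp only [Matrix.mul_apply, Fin.sum_univ_two, h10 T, h01 T] at h3
  simp at h3
  refine ⟨mlEval c T 0 0, ?_⟩
  ext i j
  fin_cases i <;> fin_cases j
  · simp
  · simpa using h01 T
  · simpa using h10 T
  · simp; linear_combination h3

theorem exists_odd_value {F : Type*} [Field F] [Infinite F] {n : ℕ} (c : Equiv.Perm (Fin n) → F)
    (hf : ¬ ∀ T : Fin n → Matrix (Fin 2) (Fin 2) F, ∃ a : F,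
      mlEval c T = a • (1 : Matrix (Fin 2) (Fin 2) F)) :
    ∃ T : Fin n → Matrix (Fin 2) (Fin 2) F,
      mlEval c T 0 0 = 0 ∧ mlEval c T 1 1 = 0 ∧ mlEval c T 0 1 ≠ 0 ∧ mlEval c T 1 0 ≠ 0 := by
  obtain ⟨u, hu⟩ := exists_basis_tuple c hf
  let U : Fin n → Matrix (Fin 2) (Fin 2) F := fun k => Matrix.single (u k).1 (u k).2 (1 : F)
  let φ := Matrix.reindexAlgEquiv F F (Equiv.swap (0 : Fin 2) 1)
  have hU : ∀ k, IsHomog2 ((u k).1 + (u k).2) (U k) := by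
    intro k i j h
    simp only [U, Matrix.single_apply] at h
    by_cases hc : (u k).1 = i ∧ (u k).2 = j
    · rw [hc.1, hc.2]
    · simp [hc] at h
  have hφU : ∀ k, IsHomog2 ((u k).1 + (u k).2) (φ (U k)) := by
    intro k i j h
    have := hU k (Equiv.swap 0 1 i) (Equiv.swap 0 1 j) (by simpa [φ] using h)
    rw [← this]
    have h3 : ∀ i j : Fin 2, i + j = Equiv.swap 0 1 i + Equiv.swap 0 1 j := by decide
    exact h3 i j
  have hsum : ∑ k, ((u k).1 + (u k).2) = 1 := by
    have := IsHomog2.mlEval c U _ hU 0 1 hu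
    rw [← this]; rfl
  have hφ : mlEval c (fun k => φ (U k)) 1 0 ≠ 0 := by
    have h2 := mlEval_map c (φ : Matrix (Fin 2) (Fin 2) F →ₐ[F] Matrix (Fin 2) (Fin 2) F) U
    simp only [AlgEquiv.coe_toAlgHom] at h2
    rw [← h2]
    simpa [φ] using hu
  -- the generic line
  let L : F → Fin n → Matrix (Fin 2) (Fin 2) F := fun t k => (1 - t) • U k + t • φ (U k)
  let G : Fin n → Matrix (Fin 2) (Fin 2) (Polynomial F) := fun k =>
    (1 - Polynomial.X : Polynomial F) • (U k).map Polynomial.C +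
      (Polynomial.X : Polynomial F) • (φ (U k)).map Polynomial.C
  have hG : ∀ t i j, (mlEval c G i j).eval t = mlEval c (L t) i j := by
    intro t i j
    have h := mlEval_map c ((Polynomial.aeval (R := F) t).mapMatrix (m := Fin 2)) G
    have h' : (fun k => ((Polynomial.aeval (R := F) t).mapMatrix (m := Fin 2)) (G k)) = L t := by
      funext k
      ext i j
      simp only [G, L, AlgHom.mapMatrix_apply, Matrix.map_apply, Matrix.add_apply,
        Matrix.smul_apply, smul_eq_mul, map_add, map_mul, map_sub, map_one, Polynomial.aeval_X,
        Polynomial.aeval_C, Algebra.algebraMap_self, RingHom.id_apply]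
    rw [h'] at h
    rw [← h]
    simp
  have h0 : mlEval c G 0 1 ≠ 0 := by
    intro h
    apply hu
    have h1 := hG 0 0 1
    rw [h] at h1
    simpa [L, U] using h1.symm
  have h1 : mlEval c G 1 0 ≠ 0 := by
    intro h
    apply hφ
    have h1 := hG 1 1 0
    rw [h] at h1
    simpa [L] using h1.symm
  obtain ⟨t, ht⟩ : ∃ t, (mlEval c G 0 1 * mlEval c G 1 0).eval t ≠ 0 := by
    by_contra! hcon
    exact mul_ne_zero h0 h1 (Polynomial.funext (by simpa using hcon))
  rw [Polynomial.eval_mul, hG, hG] at ht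
  have hL : IsHomog2 1 (mlEval c (L t)) := by
    rw [← hsum]
    refine IsHomog2.mlEval c (L t) _ fun k i j h => ?_
    simp only [L, Matrix.add_apply, Matrix.smul_apply] at h
    by_cases h4 : U k i j = 0
    · exact hφU k i j (fun h5 => by simp [h4, h5] at h)
    · exact hU k i j h4
  refine ⟨L t, ?_, ?_, left_ne_zero_of_mul ht, right_ne_zero_of_mul ht⟩
  · by_contra h
    exact absurd (hL 0 0 h) (by decide)
  · by_contra h
    exact absurd (hL 1 1 h) (by decide)

theorem aeval_intertwine {K V W : Type*} [Field K] [AddCommGroup V] [Module K V] [AddCommGroup W]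
    [Module K W] (π : V →ₗ[K] W) (A : Module.End K V) (B : Module.End K W)
    (h : ∀ v, π (A v) = B (π v)) (p : Polynomial K) (v : V) :
    π (Polynomial.aeval A p v) = Polynomial.aeval B p (π v) := by
  have hpow : ∀ (k : ℕ) v, π ((A ^ k) v) = (B ^ k) (π v) := by
    intro k
    induction k with
    | zero => simp
    | succ k ih => intro v; rw [pow_succ, pow_succ, Module.End.mul_apply, ih, h]; rfl
  induction p using Polynomial.induction_on' with
  | add p q hp hq => simp [hp, hq]
  | monomial k a => simp [Polynomial.aeval_monomial, hpow, Module.algebraMap_end_apply]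

theorem quad_dvd {K : Type*} [Field K] (A : Module.End K (Fin 2 → K)) (a b : K) (hb : b ≠ 0)
    (h0 : A ![1, 0] = ![0, b]) (h1 : A ![0, 1] = ![a, 0]) (p : Polynomial K)
    (hp : Polynomial.aeval A p ![1, 0] = 0) :
    (Polynomial.X ^ 2 - Polynomial.C (a * b)) ∣ p := by
  open Polynomial in
  have hm : (X ^ 2 - C (a * b) : K[X]).Monic := monic_X_pow_sub_C _ two_ne_zero
  have hsq : aeval A (X ^ 2 - C (a * b) : K[X]) ![1, 0] = 0 := by
    have hb' : (![0, b] : Fin 2 → K) = b • ![0, 1] := by simp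
    rw [map_sub, map_pow, aeval_X, aeval_C, LinearMap.sub_apply, pow_two,
      Module.End.mul_apply, h0, Module.algebraMap_end_apply, hb', map_smul, h1]
    ext i; fin_cases i <;> simp [mul_comm]
  rw [← modByMonic_eq_zero_iff_dvd hm]
  set r := p %ₘ (X ^ 2 - C (a * b)) with hr
  have hdeg : r.degree < 2 := by
    have := degree_modByMonic_lt p hm
    rwa [degree_X_pow_sub_C two_pos] at this
  have hr0 : aeval A r ![1, 0] = 0 := by
    have hdiv := modByMonic_add_div p (X ^ 2 - C (a * b))
    rw [← hdiv, mul_comm (X ^ 2 - C (a * b)), map_add, map_mul (aeval A), LinearMap.add_apply, Module.End.mul_apply, hsq,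
      map_zero, add_zero] at hp
    exact hp
  have hrform : r = C (r.coeff 1) * X + C (r.coeff 0) :=
    eq_X_add_C_of_degree_le_one (Order.le_of_lt_succ hdeg)
  rw [hrform] at hr0
  simp only [map_add, map_mul, aeval_X, aeval_C, LinearMap.add_apply, Module.End.mul_apply, h0,
    Module.algebraMap_end_apply] at hr0
  have e0 := congrFun hr0 0
  have e1 := congrFun hr0 1
  simp at e0 e1
  rw [hrform, e0, e1.resolve_right hb]
  simp

theorem exists_cyclic {F K : Type*} [Field F] [Infinite F] [Field K] [Algebra F K] [IsAlgClosed K]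
    {n : ℕ} (c : Equiv.Perm (Fin n) → F)
    (hf : ¬ ∀ T : Fin n → Matrix (Fin 2) (Fin 2) F, ∃ a : F,
      mlEval c T = a • (1 : Matrix (Fin 2) (Fin 2) F)) (d : ℕ) :
    ∃ (T : Fin n → Matrix (Fin d) (Fin d) K) (v : Fin d → K),
      LinearIndependent K (fun j : Fin d => (mlEval c T ^ (j : ℕ)).mulVec v) := by
  have hn : n ≠ 0 := by
    rintro rfl
    apply hf
    intro T
    refine ⟨∑ σ, c σ, ?_⟩
    simp [mlEval]
  obtain ⟨T0, h00, h11, h01, h10⟩ := exists_odd_value c hf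
  obtain ⟨m, ε, hε, hd⟩ : ∃ m ε : ℕ, ε < 2 ∧ d = 2 * m + ε :=
    ⟨d / 2, d % 2, Nat.mod_lt _ two_pos, (Nat.div_add_mod d 2).symm⟩
  -- the values over `K`
  let φ : Matrix (Fin 2) (Fin 2) F →ₐ[F] Module.End K (Fin 2 → K) :=
    ((Matrix.toLinAlgEquiv' : Matrix (Fin 2) (Fin 2) K ≃ₐ[K] _).toAlgHom.restrictScalars F).comp
      (Algebra.ofId F K).mapMatrix
  let p : K := algebraMap F K (mlEval c T0 0 1)
  let q : K := algebraMap F K (mlEval c T0 1 0)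
  have hp : p ≠ 0 := by simpa [p] using h01
  have hq : q ≠ 0 := by simpa [q] using h10
  let S : Fin n → Module.End K (Fin 2 → K) := fun k => φ (T0 k)
  have hS : mlEval c S = φ (mlEval c T0) := (mlEval_map c φ T0).symm
  have hS0 : mlEval c S ![1, 0] = ![0, q] := by
    rw [hS]
    ext i
    fin_cases i <;> simp [φ, q, Matrix.mulVec, dotProduct, h00, Algebra.ofId_apply]
  have hS1 : mlEval c S ![0, 1] = ![p, 0] := by
    rw [hS]
    ext i
    fin_cases i <;> simp [φ, p, Matrix.mulVec, dotProduct, h11, Algebra.ofId_apply]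
  -- distinct nonzero scalars
  have : Infinite K := IsAlgClosed.instInfinite
  let x : Fin m → K := fun i => ((Set.infinite_univ (α := K)).sdiff (Set.finite_singleton 0)).natEmbedding _ i
  have hxinj : Function.Injective x := fun i j hij => by
    have := Subtype.ext hij
    simpa [Fin.ext_iff] using this
  have hx0 : ∀ i, x i ≠ 0 := fun i => by
    have := (((Set.infinite_univ (α := K)).sdiff (Set.finite_singleton 0)).natEmbedding _ i).2
    simpa using this.2
  have hl : ∀ i, ∃ l : K, l ^ (n * 2) = x i := fun i =>
    IsAlgClosed.exists_pow_nat_eq _ (by positivity)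
  choose l hl using hl
  have hl0 : ∀ i, l i ≠ 0 := fun i h => hx0 i (by rw [← hl, h, zero_pow (by positivity)])
  let Sb : Fin m → Fin n → Module.End K (Fin 2 → K) := fun i k => l i • S k
  have hSb : ∀ i, mlEval c (Sb i) = l i ^ n • mlEval c S := fun i => mlEval_smul c (l i) S
  let V := (Fin m → Fin 2 → K) × (Fin ε → K)
  let T : Fin n → Module.End K V := fun k =>
    LinearMap.prodMap (LinearMap.pi fun i => (Sb i k) ∘ₗ LinearMap.proj i) 0
  let A := mlEval c T
  let v : V := (fun _ => ![1, 0], fun _ => 1)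
  have hAi : ∀ i w, (A w).1 i = mlEval c (Sb i) (w.1 i) := by
    intro i w
    exact mlEval_intertwine c ((LinearMap.proj i).comp (LinearMap.fst K _ _) : V →ₗ[K] (Fin 2 → K))
      T (Sb i) (fun k v => rfl) w
  have hAe : ∀ w, (A w).2 = 0 := by
    intro w
    have := mlEval_intertwine c (LinearMap.snd K _ _ : V →ₗ[K] (Fin ε → K))
      T (fun _ => 0) (fun k v => rfl) w
    rw [mlEval_zero hn] at this
    exact this
  let s : Fin m → K := fun i => (l i ^ n * p) * (l i ^ n * q)
  have hs : ∀ i, s i = x i * (p * q) := by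
    intro i; rw [← hl i, pow_mul]; simp only [s]; ring
  have hs0 : ∀ i, s i ≠ 0 := fun i => by
    rw [hs]; exact mul_ne_zero (hx0 i) (mul_ne_zero hp hq)
  have hsinj : ∀ i j, i ≠ j → s i ≠ s j := by
    intro i j hij h
    rw [hs, hs] at h
    exact hij (hxinj (mul_right_cancel₀ (mul_ne_zero hp hq) h))
  have key : ∀ P : Polynomial K, P.degree < d → Polynomial.aeval A P v = 0 → P = 0 := by
    open Polynomial in
    intro P hdeg hP
    have h1 : ∀ i, (X ^ 2 - C (s i)) ∣ P := by
      intro i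
      refine quad_dvd (mlEval c (Sb i)) (l i ^ n * p) (l i ^ n * q)
        (mul_ne_zero (pow_ne_zero _ (hl0 i)) hq) ?_ ?_ P ?_
      · rw [hSb, LinearMap.smul_apply, hS0]; simp
      · rw [hSb, LinearMap.smul_apply, hS1]; simp
      · have := aeval_intertwine
          ((LinearMap.proj i).comp (LinearMap.fst K _ _) : V →ₗ[K] (Fin 2 → K)) A
          (mlEval c (Sb i)) (hAi i) P v
        rw [hP, map_zero] at this
        exact this.symm
    have h2 : (X ^ ε : K[X]) ∣ P := by
      obtain rfl | rfl : ε = 0 ∨ ε = 1 := by omega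
      · simp
      · have := aeval_intertwine (LinearMap.snd K _ _ : V →ₗ[K] (Fin 1 → K)) A 0 hAe P v
        rw [hP, map_zero] at this
        have := congrFun this 0
        rw [pow_one, X_dvd_iff]
        rw [← Polynomial.coeff_zero_eq_aeval_zero'] at this
        simpa [v, Module.algebraMap_end_apply] using this.symm
    have h3 : (∏ i : Fin m, (X ^ 2 - C (s i))) ∣ P := by
      refine Finset.prod_dvd_of_coprime ?_ fun i _ => h1 i
      intro i _ j _ hij
      refine ⟨C (s j - s i)⁻¹, - C (s j - s i)⁻¹, ?_⟩
      have : s j - s i ≠ 0 := sub_ne_zero.mpr (hsinj i j hij).symm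
      calc _ = C ((s j - s i)⁻¹) * C (s j - s i) := by rw [C_sub]; ring
        _ = 1 := by rw [← C_mul, inv_mul_cancel₀ this, C_1]
    have h4 : (∏ i : Fin m, (X ^ 2 - C (s i))) * X ^ ε ∣ P := by
      refine IsCoprime.mul_dvd ?_ h3 h2
      refine IsCoprime.prod_left fun i _ => IsCoprime.pow_right ?_
      refine ⟨- C (s i)⁻¹, C (s i)⁻¹ * X, ?_⟩
      calc _ = C ((s i)⁻¹) * C (s i) := by ring
        _ = 1 := by rw [← C_mul, inv_mul_cancel₀ (hs0 i), C_1]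
    have hmon : ∀ i, (X ^ 2 - C (s i) : K[X]).Monic := fun i => monic_X_pow_sub_C _ two_ne_zero
    refine eq_zero_of_dvd_of_degree_lt h4 ?_
    rw [degree_mul, degree_prod, degree_X_pow]
    simp only [degree_X_pow_sub_C two_pos]
    refine hdeg.trans_le ?_
    rw [hd]
    simp [mul_comm]
  have hli : LinearIndependent K (fun j : Fin d => (A ^ (j : ℕ)) v) := by
    rw [Fintype.linearIndependent_iff]
    intro g hg i
    have := key (∑ j : Fin d, Polynomial.monomial (j : ℕ) (g j)) ?_ ?_
    · have := congrArg (fun P => Polynomial.coeff P i) this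
      simpa [Polynomial.finsetSum_coeff, Polynomial.coeff_monomial, Fin.val_inj] using this
    · rw [← Polynomial.mem_degreeLT]
      refine Submodule.sum_mem _ fun j _ => ?_
      rw [Polynomial.mem_degreeLT]
      exact (Polynomial.degree_monomial_le _ _).trans_lt (by exact_mod_cast j.2)
    · simpa [Polynomial.aeval_monomial, Module.algebraMap_end_apply] using hg
  have hfin : Module.finrank K V = d := by
    simp [V, hd, mul_comm, Module.finrank_pi_fintype]
  let bV : Module.Basis (Fin d) K V := Module.finBasisOfFinrankEq K V hfin
  refine ⟨fun k => LinearMap.toMatrixAlgEquiv bV (T k), bV.equivFun v, ?_⟩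
  have h5 := mlEval_map c ((LinearMap.toMatrixAlgEquiv bV).toAlgHom.restrictScalars F) T
  have h6 : (fun j : Fin d => (mlEval c (fun k => LinearMap.toMatrixAlgEquiv bV (T k)) ^ (j : ℕ)).mulVec
      (bV.equivFun v)) = bV.equivFun ∘ fun j : Fin d => (A ^ (j : ℕ)) v := by
    funext j
    have h7 : mlEval c (fun k => LinearMap.toMatrixAlgEquiv bV (T k)) =
      LinearMap.toMatrixAlgEquiv bV A := h5.symm
    rw [h7, ← map_pow]
    exact LinearMap.toMatrix_mulVec_repr bV bV (A ^ (j : ℕ)) v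
  rw [h6]
  exact hli.map' bV.equivFun.toLinearMap bV.equivFun.ker

theorem exists_transfer {F D K : Type*} [Field F] [Infinite F] [DivisionRing D] [Algebra F D]
    [Field K] [Algebra F K] {n d N : ℕ} (c : Equiv.Perm (Fin n) → F)
    (e : D →ₐ[F] Matrix (Fin d) (Fin d) K) (b : Module.Basis (Fin N) F D)
    (B : Module.Basis (Fin N) K (Matrix (Fin d) (Fin d) K)) (hB : ∀ i, B i = e (b i))
    (T : Fin n → Matrix (Fin d) (Fin d) K) (v : Fin d → K)
    (hT : LinearIndependent K (fun j : Fin d => (mlEval c T ^ (j : ℕ)).mulVec v)) :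
    ∃ cs : Fin n → D,
      LinearIndependent K (fun j : Fin d => (e (mlEval c cs) ^ (j : ℕ)).mulVec v) := by
  let R := MvPolynomial (Fin n × Fin N) K
  let G : Fin n → Matrix (Fin d) (Fin d) R := fun k =>
    ∑ l, (MvPolynomial.X (k, l) : R) • (B l).map (MvPolynomial.C : K →+* R)
  let L : (Fin n × Fin N → K) → Fin n → Matrix (Fin d) (Fin d) K := fun t k => ∑ l, t (k, l) • B l
  let Q : R := Matrix.det (Matrix.of fun (j i : Fin d) =>
    (mlEval c G ^ (j : ℕ)).mulVec (fun i => MvPolynomial.C (v i)) i)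
  have hQ : ∀ t, MvPolynomial.eval t Q = Matrix.det (Matrix.of fun (j i : Fin d) =>
      (mlEval c (L t) ^ (j : ℕ)).mulVec v i) := by
    intro t
    have h := mlEval_map c
      (((MvPolynomial.aeval t : R →ₐ[K] K).mapMatrix (m := Fin d)).restrictScalars F) G
    have h' : (fun k => (((MvPolynomial.aeval t : R →ₐ[K] K).mapMatrix
        (m := Fin d)).restrictScalars F) (G k)) = L t := by
      funext k
      simp only [G, L, map_sum, AlgHom.restrictScalars_apply]
      refine Finset.sum_congr rfl fun l _ => ?_
      ext i j
      simp
    rw [h'] at h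
    rw [← h, RingHom.map_det]
    congr 1
    ext j i
    simp only [RingHom.mapMatrix_apply, Matrix.map_apply, Matrix.of_apply,
      ← map_pow, AlgHom.restrictScalars_apply]
    simp [Matrix.mulVec, dotProduct, MvPolynomial.aeval_eq_eval]
  have hiff : ∀ A : Matrix (Fin d) (Fin d) K,
      LinearIndependent K (fun j : Fin d => (A ^ (j : ℕ)).mulVec v) ↔
      Matrix.det (Matrix.of fun (j i : Fin d) => (A ^ (j : ℕ)).mulVec v i) ≠ 0 := by
    intro A
    rw [← isUnit_iff_ne_zero, ← Matrix.isUnit_iff_isUnit_det,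
      ← Matrix.linearIndependent_rows_iff_isUnit]
    rfl
  have hQ0 : Q ≠ 0 := by
    intro h0
    have h1 := hQ (fun kl => B.repr (T kl.1) kl.2)
    have h2 : L (fun kl => B.repr (T kl.1) kl.2) = T := by
      funext k
      exact B.sum_repr (T k)
    rw [h0, map_zero, h2] at h1
    exact (hiff _).1 hT h1.symm
  obtain ⟨t, ht⟩ : ∃ t : Fin n × Fin N → F,
      MvPolynomial.eval (fun i => algebraMap F K (t i)) Q ≠ 0 := by
    by_contra! hcon
    apply hQ0
    refine MvPolynomial.funext_set (fun _ => Set.range (algebraMap F K))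
      (fun _ => Set.infinite_range_of_injective (algebraMap F K).injective) ?_
    intro x hx
    choose t ht using fun i => hx i (Set.mem_univ i)
    rw [map_zero, ← hcon t]
    congr
    funext i
    exact (ht i).symm
  refine ⟨fun k => ∑ l, t (k, l) • b l, ?_⟩
  rw [hiff, mlEval_map]
  rw [hQ] at ht
  convert ht using 6
  simp [L, hB]

theorem mem_span_of_commute {K : Type*} [Field K] {d : ℕ} (A M : Matrix (Fin d) (Fin d) K)
    (v : Fin d → K) (h : LinearIndependent K (fun j : Fin d => (A ^ (j : ℕ)).mulVec v))
    (hc : A * M = M * A) : ∃ g : Fin d → K, M = ∑ j : Fin d, g j • A ^ (j : ℕ) := by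
  let bs : Module.Basis (Fin d) K (Fin d → K) := basisOfLinearIndependentOfCardEqFinrank' _ h (by simp)
  have hbs : ∀ j, bs j = (A ^ (j : ℕ)).mulVec v := by
    intro j; simp [bs]
  refine ⟨fun j => bs.repr (M.mulVec v) j, ?_⟩
  apply Matrix.toLin'.injective
  refine bs.ext fun i => ?_
  have h1 : M.mulVec v = (∑ j : Fin d, bs.repr (M.mulVec v) j • A ^ (j : ℕ)).mulVec v := by
    conv_lhs => rw [← bs.sum_repr (M.mulVec v)]
    rw [Matrix.sum_mulVec]
    simp only [hbs, Matrix.smul_mulVec]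
  have hcM : M * A ^ (i : ℕ) = A ^ (i : ℕ) * M := by
    have : Commute A M := hc
    exact (this.pow_left i).symm.eq
  set S := (∑ j : Fin d, bs.repr (M.mulVec v) j • A ^ (j : ℕ)) with hS
  have hcS : S * A ^ (i : ℕ) = A ^ (i : ℕ) * S := by
    rw [hS, Finset.sum_mul, Finset.mul_sum]
    refine Finset.sum_congr rfl fun j _ => ?_
    rw [smul_mul_assoc, mul_smul_comm, ← pow_add, ← pow_add, add_comm]
  rw [Matrix.toLin'_apply, Matrix.toLin'_apply, hbs, Matrix.mulVec_mulVec, Matrix.mulVec_mulVec,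
    hcM, hcS, ← Matrix.mulVec_mulVec, ← Matrix.mulVec_mulVec, ← h1]

theorem centralizer_le {F D K : Type*} [Field F] [DivisionRing D] [Algebra F D]
    [Field K] [Algebra F K] {d N : ℕ}
    (e : D →ₐ[F] Matrix (Fin d) (Fin d) K) (b : Module.Basis (Fin N) F D)
    (B : Module.Basis (Fin N) K (Matrix (Fin d) (Fin d) K)) (hB : ∀ i, B i = e (b i))
    (a : D) (v : Fin d → K)
    (h : LinearIndependent K (fun j : Fin d => (e a ^ (j : ℕ)).mulVec v))
    (x : D) (hx : a * x = x * a) : x ∈ Algebra.adjoin F {a} := by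
  by_contra hxW
  change x ∉ Subalgebra.toSubmodule (Algebra.adjoin F {a}) at hxW
  obtain ⟨f, hfx, hfW⟩ := Submodule.exists_le_ker_of_notMem hxW
  let fK : Matrix (Fin d) (Fin d) K →ₗ[K] K := B.constr K (fun i => algebraMap F K (f (b i)))
  have hfK : ∀ y, fK (e y) = algebraMap F K (f y) := by
    intro y
    have h1 : (fK.restrictScalars F) ∘ₗ e.toLinearMap = (Algebra.linearMap F K) ∘ₗ f := by
      refine b.ext fun i => ?_
      simp [fK, ← hB]
    exact congrArg (fun g => g y) h1
  obtain ⟨g, hg⟩ := mem_span_of_commute (e a) (e x) v h (by rw [← map_mul, hx, map_mul])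
  apply hfx
  apply (algebraMap F K).injective
  rw [← hfK, hg, map_sum, map_zero]
  refine Finset.sum_eq_zero fun j _ => ?_
  rw [map_smul, ← map_pow, hfK]
  have : f (a ^ (j : ℕ)) = 0 :=
    hfW (Subalgebra.pow_mem _ (Algebra.self_mem_adjoin_singleton F a) _)
  rw [this]; simp

theorem maximal_of_centralizer {F D : Type*} [Field F] [DivisionRing D] [Algebra F D] (a : D)
    (h : ∀ x : D, a * x = x * a → x ∈ Algebra.adjoin F {a}) :
    IsMaximalSubfield (Subfield.closure (Set.range (algebraMap F D) ∪ {a})) := by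
  have hle : ∀ x ∈ Algebra.adjoin F {a},
      x ∈ Subfield.closure (Set.range (algebraMap F D) ∪ {a}) := by
    intro x hx
    induction hx using Algebra.adjoin_induction with
    | mem x hx => exact Subfield.subset_closure (Or.inr hx)
    | algebraMap r => exact Subfield.subset_closure (Or.inl ⟨r, rfl⟩)
    | add x y _ _ hx hy => exact add_mem hx hy
    | mul x y _ _ hx hy => exact mul_mem hx hy
  have hcomm : ∀ x ∈ Subfield.closure (Set.range (algebraMap F D) ∪ {a}), Commute a x := by
    intro x hx
    induction hx using Subfield.closure_induction with
    | mem x hx =>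
      rcases hx with ⟨r, rfl⟩ | rfl
      · exact (Algebra.commutes r a).symm
      · exact Commute.refl _
    | one => exact Commute.one_right _
    | add x y _ _ hx hy => exact hx.add_right hy
    | neg x _ hx => exact hx.neg_right
    | inv x _ hx => exact hx.inv_right₀
    | mul x y _ _ hx hy => exact hx.mul_right hy
  have ha : a ∈ Subfield.closure (Set.range (algebraMap F D) ∪ {a}) :=
    Subfield.subset_closure (Or.inr rfl)
  refine ⟨fun x hx y hy => ?_, fun L hL hKL => le_antisymm hKL fun x hx => ?_⟩
  · have hx' := h x (hcomm x hx)
    have hy' := hcomm y hy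
    have : Algebra.adjoin F {a} ≤ Subalgebra.centralizer F {y} := by
      rw [Algebra.adjoin_le_iff, Set.singleton_subset_iff]
      simp only [SetLike.mem_coe, Subalgebra.mem_centralizer_iff, Set.mem_singleton_iff, forall_eq]
      exact hy'.eq.symm
    have := this hx'
    simp only [Subalgebra.mem_centralizer_iff, Set.mem_singleton_iff, forall_eq] at this
    exact this.symm
  · exact hle x (h x (hL a (hKL ha) x hx))

/-- Let `D` be a division ring, finite-dimensional over its center `F`, and let
`f(x_1,…,x_n)` be a multilinear polynomial over `F` that is non-central over `M_2(F)`.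
Then there exist `c_1,…,c_n ∈ D` such that `F(f(c_1,…,c_n))` is a maximal subfield of `D`. -/
theorem maximal_subfield_of_multilinear
    {F D : Type*} [Field F] [DivisionRing D] [Algebra F D]
    (hcenter : Set.range (algebraMap F D) = Set.center D)
    [FiniteDimensional F D]
    {n : ℕ} (c : Equiv.Perm (Fin n) → F)
    (hf : ¬ ∀ T : Fin n → Matrix (Fin 2) (Fin 2) F, ∃ a : F,
      mlEval c T = a • (1 : Matrix (Fin 2) (Fin 2) F)) :
    ∃ cs : Fin n → D,
      IsMaximalSubfield
        (Subfield.closure (Set.range (algebraMap F D) ∪ {mlEval c cs})) := by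
  classical
  by_cases hF : Finite F
  · have : Finite D := Module.finite_of_finite F
    have commDC : ∀ x y : D, x * y = y * x := (littleWedderburn D).mul_comm
    have htop : ∀ K : Subfield D, Set.range (algebraMap F D) ⊆ K → K = ⊤ := by
      intro K hK
      rw [eq_top_iff]
      intro x _
      apply hK
      rw [hcenter, Semigroup.mem_center_iff]
      intro y
      exact commDC y x
    refine ⟨fun _ => 0, fun x _ y _ => commDC x y, fun L _ hKL => ?_⟩
    have h1 := htop _ (Set.subset_union_left.trans
      (Subfield.subset_closure (s := Set.range (algebraMap F D) ∪ {mlEval c (fun _ => (0 : D))})))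
    rw [h1] at hKL ⊢
    exact (top_le_iff.mp hKL).symm
  · have : Infinite F := not_finite_iff_infinite.mp hF
    obtain ⟨d, e, he⟩ := exists_splitting (AlgebraicClosure F) hcenter
    let b := Module.finBasis F D
    obtain ⟨B, hB⟩ := he b
    obtain ⟨T, v, hT⟩ := exists_cyclic (K := AlgebraicClosure F) c hf d
    obtain ⟨cs, hcs⟩ := exists_transfer c e b B hB T v hT
    exact ⟨cs, maximal_of_centralizer _ fun x hx => centralizer_le e b B hB _ v hcs x hx⟩
end

section
/- Let D be a division ring that is finite-dimensional over its center F, and let w(x_1,…,x_n) be a non-trivial group word. Then there exist invertible elements c_1,…,c_n ∈ D such that F(w(c_1,…,c_n)) is a maximal subfield of D. -/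
open scoped TensorProduct

theorem tensor_simple_aux {F D K : Type*} [Field F] [DivisionRing D] [Algebra F D]
    [Field K] [Algebra F K]
    (hc : Set.range (algebraMap F D) = Set.center D) : IsSimpleRing (K ⊗[F] D) := by
  classical
  have : Nontrivial (K ⊗[F] D) := by
    have : Function.Injective (algebraMap K (K ⊗[F] D)) :=
      FaithfulSMul.algebraMap_injective _ _
    exact this.nontrivial
  refine ⟨⟨fun I => ?_⟩⟩
  by_cases hI : I = ⊥
  · exact Or.inl hI
  right
  obtain ⟨x0, hx0, hx0'⟩ : ∃ x ∈ I, x ≠ 0 := by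
    by_contra! h
    apply hI
    ext x
    rw [TwoSidedIdeal.mem_bot]
    exact ⟨h x, fun h => h ▸ I.zero_mem⟩
  let b := Module.Free.chooseBasis F K
  let e := TensorProduct.equivFinsuppOfBasisLeft (N := D) b
  have eL : ∀ (d : D) (x : K ⊗[F] D) i, e ((1 ⊗ₜ d) * x) i = d * e x i := by
    intro d x i
    induction x with
    | zero => simp
    | add x y hx hy => simp [mul_add, hx, hy]
    | tmul k d' => simp [e]
  have eR : ∀ (d : D) (x : K ⊗[F] D) i, e (x * (1 ⊗ₜ d)) i = e x i * d := by
    intro d x i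
    induction x with
    | zero => simp
    | add x y hx hy => simp [add_mul, hx, hy]
    | tmul k d' => simp [e]
  let P : ℕ → Prop := fun n => ∃ x ∈ I, x ≠ 0 ∧ (e x).support.card = n
  have hP : ∃ n, P n := ⟨_, x0, hx0, hx0', rfl⟩
  obtain ⟨x, hxI, hxne, hcard⟩ := Nat.find_spec hP
  have hmin : ∀ y ∈ I, (e y).support.card < (e x).support.card → y = 0 := by
    intro y hy hlt
    by_contra hne
    exact Nat.find_min hP (hcard ▸ hlt) ⟨y, hy, hne, rfl⟩
  obtain ⟨i0, hi0⟩ : ∃ i, e x i ≠ 0 := by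
    by_contra! h
    exact hxne (e.injective (by ext i; simp [h]))
  let x' := (1 ⊗ₜ (e x i0)⁻¹ : K ⊗[F] D) * x
  have hx'I : x' ∈ I := I.mul_mem_left _ _ hxI
  have hx'1 : e x' i0 = 1 := by simp only [x', eL]; exact inv_mul_cancel₀ hi0
  have hsupp : (e x').support ⊆ (e x).support := by
    intro i
    simp only [Finsupp.mem_support_iff, x', eL]
    exact fun h => right_ne_zero_of_mul h
  have hcomm : ∀ d : D, (1 ⊗ₜ d : K ⊗[F] D) * x' = x' * (1 ⊗ₜ d) := by
    intro d
    rw [← sub_eq_zero]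
    apply hmin _ (I.sub_mem (I.mul_mem_left _ _ hx'I) (I.mul_mem_right _ _ hx'I))
    apply Finset.card_lt_card
    rw [Finset.ssubset_iff_of_subset]
    · refine ⟨i0, by simpa using hi0, ?_⟩
      simp [eL, eR, hx'1]
    · intro i hi
      apply hsupp
      simp only [Finsupp.mem_support_iff, map_sub, Finsupp.sub_apply, eL, eR] at hi ⊢
      intro h
      simp [h] at hi
  have hF : ∀ i, ∃ f : F, algebraMap F D f = e x' i := by
    intro i
    have : e x' i ∈ Set.center D := by
      rw [Semigroup.mem_center_iff]
      intro d
      rw [← eL, ← eR, hcomm]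
    rwa [← hc] at this
  choose f hf using hF
  have hk : ∃ k : K, x' = k ⊗ₜ 1 := by
    have h1 : x' = e.symm (e x') := by simp
    rw [TensorProduct.equivFinsuppOfBasisLeft_symm_apply] at h1
    refine ⟨(e x').sum fun i _ => f i • b i, h1.trans ?_⟩
    rw [Finsupp.sum, Finsupp.sum, TensorProduct.sum_tmul]
    refine Finset.sum_congr rfl fun i _ => ?_
    rw [TensorProduct.smul_tmul, ← hf, Algebra.algebraMap_eq_smul_one]
  obtain ⟨k, hk⟩ := hk
  have hk0 : k ≠ 0 := by
    rintro rfl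
    rw [TensorProduct.zero_tmul] at hk
    simp [hk] at hx'1
  have h1 : (1 : K ⊗[F] D) ∈ I := by
    have := I.mul_mem_left (k⁻¹ ⊗ₜ 1) _ hx'I
    rwa [hk, Algebra.TensorProduct.tmul_mul_tmul, inv_mul_cancel₀ hk0, one_mul,
      ← Algebra.TensorProduct.one_def] at this
  exact (TwoSidedIdeal.one_mem_iff I).1 h1

section PolyPart
open Polynomial

theorem diag_two {K : Type*} [Field K] (M : Matrix (Fin 2) (Fin 2) K) (l m : K) (hne : l ≠ m)
    (ht : M.trace = l + m) (hd : M.det = l * m) :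
    ∃ Q : (Matrix (Fin 2) (Fin 2) K)ˣ,
      M = (Q : Matrix (Fin 2) (Fin 2) K) * Matrix.diagonal ![l, m] * ((Q⁻¹ : (Matrix (Fin 2) (Fin 2) K)ˣ) : Matrix (Fin 2) (Fin 2) K) := by
  rw [Matrix.trace_fin_two] at ht
  rw [Matrix.det_fin_two] at hd
  have ev : ∀ t : K, (t - l) * (t - m) = 0 → ∃ v ≠ 0, M.mulVec v = t • v := by
    intro t h
    have : (M - t • (1 : Matrix (Fin 2) (Fin 2) K)).det = 0 := by
      rw [Matrix.det_fin_two]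
      simp
      linear_combination h + hd - t * ht
    obtain ⟨v, hv, h2⟩ := Matrix.exists_mulVec_eq_zero_iff.2 this
    refine ⟨v, hv, ?_⟩
    rw [Matrix.sub_mulVec, Matrix.smul_mulVec, Matrix.one_mulVec] at h2
    exact sub_eq_zero.1 h2
  obtain ⟨u, hu, hMu⟩ := ev l (by simp)
  obtain ⟨v, hv, hMv⟩ := ev m (by simp)
  let Q : Matrix (Fin 2) (Fin 2) K := !![u 0, v 0; u 1, v 1]
  have hu0 := congrFun hMu 0
  have hu1 := congrFun hMu 1
  have hv0 := congrFun hMv 0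
  have hv1 := congrFun hMv 1
  simp [Matrix.mulVec, dotProduct, Fin.sum_univ_two] at hu0 hu1 hv0 hv1
  have hQ : Q.det ≠ 0 := by
    intro h0
    obtain ⟨z, hz, h2⟩ := Matrix.exists_mulVec_eq_zero_iff.2 h0
    have e0 := congrFun h2 0
    have e1 := congrFun h2 1
    simp [Q, Matrix.mulVec, dotProduct, Fin.sum_univ_two] at e0 e1
    have hlm : m - l ≠ 0 := sub_ne_zero.2 hne.symm
    have f0 : (m - l) * (z 1 * v 0) = 0 := by
      linear_combination M 0 0 * e0 + M 0 1 * e1 - z 0 * hu0 - z 1 * hv0 - l * e0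
    have f1 : (m - l) * (z 1 * v 1) = 0 := by
      linear_combination M 1 0 * e0 + M 1 1 * e1 - z 0 * hu1 - z 1 * hv1 - l * e1
    have z1 : z 1 = 0 := by
      by_contra hz1
      apply hv
      ext i
      fin_cases i
      · simpa [hlm, hz1] using f0
      · simpa [hlm, hz1] using f1
    have z0 : z 0 = 0 := by
      by_contra hz0
      apply hu
      ext i
      fin_cases i
      · simpa [z1, hz0] using e0
      · simpa [z1, hz0] using e1
    apply hz
    ext i
    fin_cases i
    · exact z0
    · exact z1
  have hQu : IsUnit Q := (Matrix.isUnit_iff_isUnit_det Q).2 (isUnit_iff_ne_zero.2 hQ)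
  refine ⟨hQu.unit, ?_⟩
  rw [Units.eq_mul_inv_iff_mul_eq, IsUnit.unit_spec]
  ext i j
  fin_cases i <;> fin_cases j <;> simp [Q, Matrix.mul_apply, Fin.sum_univ_two]
  · linear_combination hu0
  · linear_combination hv0
  · linear_combination hu1
  · linear_combination hv1

theorem word_scalar {K A X : Type*} [Field K] [Ring A] [Algebra K A] (g : X → Aˣ)
    (B : X × Bool → A) (h1 : ∀ x, B (x, true) = g x)
    (h2 : ∀ x, ∃ c : K, c ≠ 0 ∧ B (x, false) = c • ((g x)⁻¹ : Aˣ)) (L : List (X × Bool)) :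
    ∃ c : K, c ≠ 0 ∧ (L.map B).prod = c • ((FreeGroup.lift g (FreeGroup.mk L) : Aˣ) : A) := by
  rw [FreeGroup.lift_mk]
  induction L with
  | nil => exact ⟨1, one_ne_zero, by simp⟩
  | cons a L ih =>
    obtain ⟨c, hc, ih⟩ := ih
    obtain ⟨x, b⟩ := a
    cases b
    · obtain ⟨d, hd, h⟩ := h2 x
      refine ⟨d * c, mul_ne_zero hd hc, ?_⟩
      simp [ih, h, smul_smul, mul_comm c d]
    · refine ⟨c, hc, ?_⟩
      simp [ih, h1]

/-- rank one letters -/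
def letR {K X : Type*} [Field K] (α : X × Bool → K) (l : X × Bool) : Matrix (Fin 2) (Fin 2) K :=
  Matrix.vecMulVec ![1, α l] ![-α (l.1, !l.2), 1]

theorem letR_prod {K X : Type*} [Field K] (α : X × Bool → K) (hα : Function.Injective α)
    (L : List (X × Bool)) : ∀ (l : X × Bool), FreeGroup.IsReduced (l :: L) →
    ∃ c : K, c ≠ 0 ∧ ((l :: L).map (letR α)).prod =
      c • Matrix.vecMulVec ![1, α l] ![-α (((l :: L).getLast (by simp)).1, !((l :: L).getLast (by simp)).2), 1] := by
  induction L with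
  | nil => intro l _; exact ⟨1, one_ne_zero, by simp [letR]⟩
  | cons a L ih =>
    intro l h
    obtain ⟨h1, h2⟩ := List.isChain_cons_cons.1 h
    obtain ⟨c, hc, ih⟩ := ih a h2
    have hne : α a - α (l.1, !l.2) ≠ 0 := by
      rw [sub_ne_zero]
      intro h
      have := hα h
      rw [this] at h1
      simp at h1
    refine ⟨c * (α a - α (l.1, !l.2)), mul_ne_zero hc hne, ?_⟩
    have hl : (l :: a :: L).getLast (by simp) = (a :: L).getLast (by simp) :=
      List.getLast_cons (by simp)
    rw [List.map_cons, List.prod_cons, ih, hl]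
    generalize (a :: L).getLast (by simp) = z
    ext i j
    fin_cases i <;> fin_cases j <;>
      simp [letR, Matrix.mul_apply, Matrix.vecMulVec, Fin.sum_univ_two] <;> ring

theorem letR_trace {K X : Type*} [Field K] (α : X × Bool → K) (hα : Function.Injective α)
    (L : List (X × Bool)) (hL : L ≠ []) (h : FreeGroup.IsCyclicallyReduced L) :
    (L.map (letR α)).prod.trace ≠ 0 ∧ (L.map (letR α)).prod.det = 0 := by
  cases L with
  | nil => simp at hL
  | cons a L =>
    obtain ⟨c, hc, e⟩ := letR_prod α hα L a h.1
    rw [e]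
    constructor
    · have h2 := h.2 ((a :: L).getLast (by simp)) (by simp [List.getLast?_eq_getLast_of_ne_nil]) a (by simp)
      set z := (a :: L).getLast (by simp)
      rw [Matrix.trace_smul, Matrix.trace_vecMulVec]
      simp only [smul_eq_mul]
      refine mul_ne_zero hc ?_
      simp [dotProduct, Fin.sum_univ_two]
      rw [neg_add_eq_sub, sub_eq_zero]
      intro h
      have := hα h
      rw [this] at h2
      simp at h2
    · rw [Matrix.det_fin_two]
      simp
      ring

/-- The pencil of letters. -/
def letB {K X : Type*} [Field K] (α : X × Bool → K) (s : K) (l : X × Bool) :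
    Matrix (Fin 2) (Fin 2) K :=
  letR α l - s • letR α (l.1, !l.2)

theorem letB_mul {K X : Type*} [Field K] (α : X × Bool → K) (s : K) (x : X) (b : Bool) :
    letB α s (x, b) * letB α s (x, !b) =
      (-(s * (α (x, b) - α (x, !b)) ^ 2)) • (1 : Matrix (Fin 2) (Fin 2) K) := by
  ext i j
  fin_cases i <;> fin_cases j <;>
    simp [letB, letR, Matrix.mul_apply, Matrix.vecMulVec, Fin.sum_univ_two] <;> ring

theorem letB_poly {K X : Type*} [Field K] (α : X × Bool → K) (L : List (X × Bool)) :
    ∃ M : Matrix (Fin 2) (Fin 2) K[X], ∀ s : K,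
      (evalRingHom s).mapMatrix M = (L.map (letB α s)).prod := by
  refine ⟨(L.map fun l => (letR α l).map C - (Polynomial.X : K[X]) • (letR α (l.1, !l.2)).map C).prod, ?_⟩
  intro s
  rw [map_list_prod, List.map_map]
  congr 1
  apply List.map_congr_left
  intro l _
  ext i j
  simp [letB]
  exact mul_comm _ _

theorem exists_gl2 {K : Type*} [Field K] [IsAlgClosed K] {n : ℕ} (w : FreeGroup (Fin n))
    (hw : w ≠ 1) (N : ℕ) :
    ∃ (g : Fin n → (Matrix (Fin 2) (Fin 2) K)ˣ) (Q : (Matrix (Fin 2) (Fin 2) K)ˣ) (l m : K),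
      l ≠ 0 ∧ m ≠ 0 ∧ (∀ k, 0 < k → k ≤ N → l ^ k ≠ m ^ k) ∧
      ((FreeGroup.lift g w : (Matrix (Fin 2) (Fin 2) K)ˣ) : Matrix (Fin 2) (Fin 2) K) =
        (Q : Matrix (Fin 2) (Fin 2) K) * Matrix.diagonal ![l, m] *
          ((Q⁻¹ : (Matrix (Fin 2) (Fin 2) K)ˣ) : Matrix (Fin 2) (Fin 2) K) := by
  classical
  have : Infinite K := IsAlgClosed.instInfinite
  let α : (Fin n × Bool) ↪ K := ((Fintype.equivFin (Fin n × Bool)).toEmbedding.trans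
    Fin.valEmbedding).trans (Infinite.natEmbedding K)
  let h := FreeGroup.mk (FreeGroup.reduceCyclically.conjugator w.toWord)
  let L := FreeGroup.reduceCyclically w.toWord
  have hwL : w = h * FreeGroup.mk L * h⁻¹ := by
    rw [← FreeGroup.mk_toWord (x := w), ← FreeGroup.reduceCyclically.conj_conjugator_reduceCyclically w.toWord]
    simp [h, L, FreeGroup.mul_mk, FreeGroup.inv_mk]
  have hL : L ≠ [] := by
    intro h0
    apply hw
    rw [hwL, h0, ← FreeGroup.one_eq_mk]
    simp
  have hcyc : FreeGroup.IsCyclicallyReduced L :=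
    FreeGroup.reduceCyclically.isCyclicallyReduced FreeGroup.isReduced_toWord
  obtain ⟨M, hM⟩ := letB_poly α L
  have hT : ∀ s : K, M.trace.eval s = ((L.map (letB α s)).prod).trace := by
    intro s
    rw [← hM]
    simp [Matrix.trace]
  have hd : ∀ s : K, M.det.eval s = ((L.map (letB α s)).prod).det := by
    intro s
    rw [← hM, ← coe_evalRingHom, RingHom.map_det]
  have hB0 : letB (α : Fin n × Bool → K) 0 = letR α := by
    ext1 l; simp [letB]
  obtain ⟨tr0, det0⟩ := letR_trace α α.injective L hL hcyc
  rw [← hB0, ← hT] at tr0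
  rw [← hB0, ← hd] at det0
  let q := (N + 1).factorial
  have hq : 0 < q := Nat.factorial_pos _
  let Z : Finset K := (nthRoots q (1 : K)).toFinset
  let P : K[X] := X * ∏ r ∈ Z, (C r * M.trace ^ 2 - C ((r + 1) ^ 2) * M.det)
  have hP : P ≠ 0 := by
    refine mul_ne_zero X_ne_zero (Finset.prod_ne_zero_iff.2 fun r hr h0 => ?_)
    have := congrArg (eval 0) h0
    simp [det0, tr0] at this
    rw [Multiset.mem_toFinset, mem_nthRoots hq, this, zero_pow hq.ne'] at hr
    exact zero_ne_one hr
  obtain ⟨s, hs⟩ : ∃ s, P.eval s ≠ 0 := by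
    by_contra! h
    exact hP (Polynomial.funext (by simpa using h))
  simp only [P, eval_mul, eval_X, eval_prod, mul_ne_zero_iff, Finset.prod_ne_zero_iff] at hs
  obtain ⟨hs0, hsZ⟩ := hs
  have hdel : ∀ x b, -(s * (α (x, b) - α (x, !b)) ^ 2) ≠ 0 := by
    intro x b
    rw [neg_ne_zero]
    refine mul_ne_zero hs0 (pow_ne_zero _ (sub_ne_zero.2 fun h => ?_))
    have := α.injective h
    simp at this
  let g : Fin n → (Matrix (Fin 2) (Fin 2) K)ˣ := fun x =>
    { val := letB α s (x, true)
      inv := (-(s * (α (x, true) - α (x, false)) ^ 2))⁻¹ • letB α s (x, false)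
      val_inv := by
        rw [Matrix.mul_smul]
        have := letB_mul α s x true
        rw [Bool.not_true] at this
        rw [this, smul_smul, inv_mul_cancel₀ (by simpa using hdel x true), one_smul]
      inv_val := by
        rw [Matrix.smul_mul]
        have := letB_mul α s x false
        rw [Bool.not_false] at this
        rw [this, smul_smul, sub_sq_comm, inv_mul_cancel₀ (by simpa using hdel x false), one_smul] }
  obtain ⟨c, hc, hcM⟩ := word_scalar (K := K) g (letB α s) (fun x => rfl)
    (fun x => ⟨_, hdel x true, by
      change _ = _ • (_ • _)
      rw [Bool.not_true, smul_smul, mul_inv_cancel₀ (by simpa using hdel x true), one_smul]⟩) L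
  set U := FreeGroup.lift g (FreeGroup.mk L) with hU
  have hTs : M.trace.eval s = c * (U : Matrix (Fin 2) (Fin 2) K).trace := by
    rw [hT, hcM, Matrix.trace_smul, smul_eq_mul]
  have hds : M.det.eval s = c ^ 2 * (U : Matrix (Fin 2) (Fin 2) K).det := by
    rw [hd, hcM, Matrix.det_smul]; simp
  have hU0 : (U : Matrix (Fin 2) (Fin 2) K).det ≠ 0 := by
    have := (Matrix.isUnit_iff_isUnit_det _).1 U.isUnit
    exact this.ne_zero
  obtain ⟨l, hl⟩ := IsAlgClosed.exists_root (X ^ 2 - C (U : Matrix (Fin 2) (Fin 2) K).trace * X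
    + C (U : Matrix (Fin 2) (Fin 2) K).det) (by
      have : (X ^ 2 - C (U : Matrix (Fin 2) (Fin 2) K).trace * X
        + C (U : Matrix (Fin 2) (Fin 2) K).det).degree = 2 := by compute_degree!
      rw [this]; decide)
  simp [IsRoot] at hl
  set m := (U : Matrix (Fin 2) (Fin 2) K).trace - l with hm
  have ht : (U : Matrix (Fin 2) (Fin 2) K).trace = l + m := by rw [hm]; ring
  have hdet : (U : Matrix (Fin 2) (Fin 2) K).det = l * m := by
    rw [hm]; linear_combination hl
  have hlm : l ≠ 0 ∧ m ≠ 0 := by rwa [hdet, mul_ne_zero_iff] at hU0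
  have hk : ∀ k, 0 < k → k ≤ N + 1 → l ^ k ≠ m ^ k := by
    intro k hk0 hkN he
    have hr : l / m ∈ Z := by
      rw [Multiset.mem_toFinset, mem_nthRoots hq]
      obtain ⟨j, hj⟩ := Nat.dvd_factorial hk0 hkN
      rw [show q = k * j from hj, pow_mul, div_pow, he, div_self (pow_ne_zero _ hlm.2), one_pow]
    apply hsZ _ hr
    simp only [eval_sub, eval_mul, eval_C, eval_pow]
    rw [hTs, hds, ht, hdet]
    have := hlm.2
    field_simp
    ring
  obtain ⟨Q, hQ⟩ := diag_two (U : Matrix (Fin 2) (Fin 2) K) l m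
    (by simpa using hk 1 one_pos (by omega)) ht hdet
  refine ⟨g, FreeGroup.lift g h * Q, l, m, hlm.1, hlm.2, fun k h1 h2 => hk k h1 (by omega), ?_⟩
  rw [hwL, map_mul, map_mul, map_inv, ← hU, Units.val_mul, Units.val_mul, hQ, mul_inv_rev,
    Units.val_mul, Units.val_mul]
  simp only [mul_assoc]

/-- Symmetric power of a two by two matrix. -/
noncomputable def symPow {K : Type*} [Field K] (N : ℕ) (g : Matrix (Fin 2) (Fin 2) K) :
    Matrix (Fin (N+1)) (Fin (N+1)) K :=
  fun i j => ((C (g 0 0) * X + C (g 1 0)) ^ (j : ℕ) * (C (g 0 1) * X + C (g 1 1)) ^ (N - j)).coeff i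

theorem hom_lin {K A : Type*} [Field K] [CommRing A] [Algebra K A] (N : ℕ) (a b c d : K) (x y : A)
    (j : ℕ) (hj : j ≤ N) :
    ∑ k : Fin (N+1), algebraMap K A (((C a * X + C c) ^ j * (C b * X + C d) ^ (N - j)).coeff k)
      * (x ^ (k:ℕ) * y ^ (N - k)) =
    (algebraMap K A a * x + algebraMap K A c * y)^j * (algebraMap K A b * x + algebraMap K A d * y)^(N-j) := by
  have hl : ∀ a c : K, (C a * X + C c).natDegree ≤ 1 := fun a c => natDegree_linear_le
  have hp : ∀ (a c : K) (n : ℕ), ((C a * X + C c)^n).homogenize n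
      = (MvPolynomial.C a * MvPolynomial.X 0 + MvPolynomial.C c * MvPolynomial.X 1)^n ∧
      ((C a * X + C c)^n).natDegree ≤ n := by
    intro a c n
    have hd : ∀ n, ((C a * X + C c)^n).natDegree ≤ n := fun n => by
      simpa using natDegree_pow_le_of_le n (hl a c)
    refine ⟨?_, hd n⟩
    induction n with
    | zero => simp
    | succ n ih =>
      rw [pow_succ, homogenize_mul _ _ (hd n) (hl a c), ih, pow_succ]
      simp
  have key := homogenize_mul _ _ (hp a c j).2 (hp b d (N-j)).2
  rw [(hp a c j).1, (hp b d (N-j)).1, Nat.add_sub_cancel' hj] at key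
  have := congrArg (MvPolynomial.aeval ![x, y]) key
  simp only [map_mul, map_pow, map_add, MvPolynomial.aeval_C, MvPolynomial.aeval_X] at this
  simp only [Matrix.cons_val_zero, Matrix.cons_val_one] at this
  rw [← this, homogenize, Finset.Nat.sum_antidiagonal_eq_sum_range_succ_mk, Finset.sum_range, map_sum]
  refine Finset.sum_congr rfl fun k _ => ?_
  simp [MvPolynomial.aeval_monomial, Finsupp.prod_fintype]

theorem symPow_mul {K : Type*} [Field K] (N : ℕ) (g h : Matrix (Fin 2) (Fin 2) K) :
    symPow N (g * h) = symPow N g * symPow N h := by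
  ext i j
  have := hom_lin (A := K[X]) N (h 0 0) (h 0 1) (h 1 0) (h 1 1) (C (g 0 0) * X + C (g 1 0))
    (C (g 0 1) * X + C (g 1 1)) j (by omega)
  have := congrArg (fun p => p.coeff (i:ℕ)) this
  simp only [finsetSum_coeff, algebraMap_eq, coeff_C_mul] at this
  rw [Matrix.mul_apply]
  simp only [symPow]
  calc _ = _ := ?_
    _ = _ := this.symm
    _ = _ := Finset.sum_congr rfl fun k _ => mul_comm _ _
  congr 3 <;> simp [Matrix.mul_apply, Fin.sum_univ_two] <;> ring

theorem symPow_diag {K : Type*} [Field K] (N : ℕ) (a b : K) :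
    symPow N (Matrix.diagonal ![a, b]) = Matrix.diagonal fun i : Fin (N+1) => a ^ (i:ℕ) * b ^ (N - i) := by
  ext i j
  have : ((C a * X + C 0) ^ (j:ℕ) * (C 0 * X + C b) ^ (N - j)) = C (a ^ (j:ℕ) * b ^ (N - j)) * X ^ (j:ℕ) := by
    simp [mul_pow]; ring
  simp only [symPow]
  simp only [Matrix.diagonal_apply, Matrix.cons_val_zero, Matrix.cons_val_one, if_true, one_ne_zero, zero_ne_one, if_false, this, coeff_C_mul_X_pow, Fin.ext_iff]
  split_ifs with h <;> simp_all

theorem symPow_one {K : Type*} [Field K] (N : ℕ) : symPow N (1 : Matrix (Fin 2) (Fin 2) K) = 1 := by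
  have := symPow_diag N (1:K) 1
  simp only [one_pow, mul_one, Matrix.diagonal_one] at this
  rw [← this]; congr 1
  ext i j; fin_cases i <;> fin_cases j <;> simp

/-- Symmetric power as a monoid hom. -/
noncomputable def symHom (K : Type*) [Field K] (N : ℕ) :
    Matrix (Fin 2) (Fin 2) K →* Matrix (Fin (N+1)) (Fin (N+1)) K where
  toFun := symPow N
  map_one' := symPow_one N
  map_mul' := symPow_mul N

/-- Krylov matrix. -/
def kry {R : Type*} [CommRing R] {m : ℕ} (A : Matrix (Fin m) (Fin m) R) (v : Fin m → R) :
    Matrix (Fin m) (Fin m) R :=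
  Matrix.of fun i j => ((A ^ (j : ℕ)).mulVec v) i

theorem kry_smul {K : Type*} [Field K] {m : ℕ} (A : Matrix (Fin m) (Fin m) K) (v : Fin m → K)
    (c : K) (hc : c ≠ 0) : (kry (c • A) v).det ≠ 0 ↔ (kry A v).det ≠ 0 := by
  have : kry (c • A) v = kry A v * Matrix.diagonal fun j : Fin m => c ^ (j : ℕ) := by
    ext i j
    simp [kry, _root_.smul_pow, Matrix.smul_mulVec, mul_comm]
  rw [this, Matrix.det_mul, Matrix.det_diagonal, mul_ne_zero_iff]
  simp [Finset.prod_ne_zero_iff, hc]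

theorem kry_comm {K : Type*} [Field K] {m : ℕ} (A : Matrix (Fin m) (Fin m) K) (v : Fin m → K)
    (h : (kry A v).det ≠ 0) (Y : Matrix (Fin m) (Fin m) K) (hY : Y * A = A * Y) :
    ∃ c : Fin m → K, Y = ∑ j, c j • A ^ (j : ℕ) := by
  have hu : IsUnit (kry A v) := (Matrix.isUnit_iff_isUnit_det _).2 (isUnit_iff_ne_zero.2 h)
  obtain ⟨c, hc⟩ := Matrix.mulVec_surjective_iff_isUnit.2 hu (Y.mulVec v)
  refine ⟨c, ?_⟩
  have hc' : Y.mulVec v = (∑ j, c j • A ^ (j : ℕ)).mulVec v := by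
    rw [← hc, Matrix.sum_mulVec]
    ext i
    simp [Matrix.mulVec, dotProduct, kry, mul_comm, Finset.sum_apply, Finset.mul_sum, mul_left_comm]
  have hp : (∑ j, c j • A ^ (j : ℕ)) * A = A * ∑ j, c j • A ^ (j : ℕ) := by
    simp [Finset.sum_mul, Finset.mul_sum, ← pow_succ, ← pow_succ']
  have hk : Y * kry A v = (∑ j, c j • A ^ (j : ℕ)) * kry A v := by
    generalize (∑ j, c j • A ^ (j : ℕ)) = p at *
    ext i j
    have e : ∀ B : Matrix (Fin m) (Fin m) K, B * A = A * B →
        (B * kry A v) i j = ((A ^ (j : ℕ)).mulVec (B.mulVec v)) i := by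
      intro B hB
      have hB' : A ^ (j : ℕ) * B = B * A ^ (j : ℕ) :=
        (Commute.pow_right (show Commute B A from hB) j).eq.symm
      rw [Matrix.mulVec_mulVec, hB', ← Matrix.mulVec_mulVec]
      rfl
    rw [e Y hY, e p hp, hc']
  exact hu.mul_left_injective hk

theorem exists_glm {K : Type*} [Field K] [IsAlgClosed K] {n : ℕ} (w : FreeGroup (Fin n))
    (hw : w ≠ 1) (N : ℕ) :
    ∃ (g : Fin n → (Matrix (Fin (N + 1)) (Fin (N + 1)) K)ˣ) (v : Fin (N + 1) → K),
      (kry ((FreeGroup.lift g w : (Matrix (Fin (N + 1)) (Fin (N + 1)) K)ˣ) :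
        Matrix (Fin (N + 1)) (Fin (N + 1)) K) v).det ≠ 0 := by
  obtain ⟨g, Q, l, m, hl, hm, hk, e⟩ := exists_gl2 (K := K) w hw N
  let S := Units.map (symHom K N) Q
  let d : Fin (N + 1) → K := fun i => l ^ (i : ℕ) * m ^ (N - i)
  refine ⟨fun i => Units.map (symHom K N) (g i), S.val.mulVec 1, ?_⟩
  have h1 : FreeGroup.lift (fun i => Units.map (symHom K N) (g i)) w =
      Units.map (symHom K N) (FreeGroup.lift g w) := by
    have : FreeGroup.lift (fun i => Units.map (symHom K N) (g i)) =
      (Units.map (symHom K N)).comp (FreeGroup.lift g) := by ext; simp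
    rw [this]; rfl
  have h2 : ((Units.map (symHom K N) (FreeGroup.lift g w) :
      (Matrix (Fin (N + 1)) (Fin (N + 1)) K)ˣ) : Matrix (Fin (N + 1)) (Fin (N + 1)) K) =
      S * Matrix.diagonal d * ((S⁻¹ : (Matrix (Fin (N + 1)) (Fin (N + 1)) K)ˣ) :
        Matrix (Fin (N + 1)) (Fin (N + 1)) K) := by
    rw [Units.coe_map, e]
    simp only [map_mul]
    rw [show symHom K N (Matrix.diagonal ![l, m]) = Matrix.diagonal d from symPow_diag N l m]
    rfl
  rw [h1, h2]
  have h3 : ∀ j : ℕ, (S.val * Matrix.diagonal d *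
      ((S⁻¹ : (Matrix (Fin (N + 1)) (Fin (N + 1)) K)ˣ) : Matrix (Fin (N + 1)) (Fin (N + 1)) K)) ^ j
      = S * Matrix.diagonal (fun i => d i ^ j) *
      ((S⁻¹ : (Matrix (Fin (N + 1)) (Fin (N + 1)) K)ˣ) : Matrix (Fin (N + 1)) (Fin (N + 1)) K) := by
    intro j
    rw [Units.conj_pow, Matrix.diagonal_pow]
    rfl
  have h4 : kry (S.val * Matrix.diagonal d *
      ((S⁻¹ : (Matrix (Fin (N + 1)) (Fin (N + 1)) K)ˣ) : Matrix (Fin (N + 1)) (Fin (N + 1)) K))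
      (S.val.mulVec 1) = S * Matrix.vandermonde d := by
    ext i j
    simp only [kry, Matrix.of_apply, h3]
    rw [Matrix.mulVec_mulVec, mul_assoc, Units.inv_mul, mul_one]
    simp [Matrix.mulVec, dotProduct, Matrix.mul_apply,
      Matrix.vandermonde_apply, Matrix.diagonal_apply]
  rw [h4, Matrix.det_mul]
  refine mul_ne_zero ((Matrix.isUnit_iff_isUnit_det _).1 S.isUnit).ne_zero ?_
  rw [Matrix.det_vandermonde_ne_zero_iff]
  have key : ∀ i j : Fin (N + 1), i < j → d i ≠ d j := by
    intro i j hij he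
    have hij' : (i : ℕ) < j := hij
    have hj := j.2
    apply hk (j - i) (by omega) (by omega)
    simp only [d] at he
    have e1 : (j : ℕ) = i + (j - i) := by omega
    have e2 : N - (i : ℕ) = (N - j) + (j - i) := by omega
    rw [e2, pow_add] at he
    nth_rw 3 [e1] at he
    rw [pow_add] at he
    have hne : l ^ (i : ℕ) * m ^ (N - (j : ℕ)) ≠ 0 :=
      mul_ne_zero (pow_ne_zero _ hl) (pow_ne_zero _ hm)
    apply mul_left_cancel₀ hne
    linear_combination -he
  intro i j he
  rcases lt_trichotomy i j with h | h | h
  · exact absurd he (key i j h)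
  · exact h
  · exact absurd he.symm (key j i h)

end PolyPart

theorem closure_comm {D : Type*} [DivisionRing D] (s : Set D)
    (hs : ∀ x ∈ s, ∀ y ∈ s, x * y = y * x) :
    ∀ x ∈ Subfield.closure s, ∀ y ∈ Subfield.closure s, x * y = y * x := by
  have step : ∀ (t : Set D) (y : D), (∀ x ∈ t, x * y = y * x) →
      ∀ x ∈ Subfield.closure t, x * y = y * x := by
    intro t y ht x hx
    induction hx using Subfield.closure_induction with
    | mem x hx => exact ht x hx
    | one => simp
    | add a b _ _ ha hb => rw [add_mul, mul_add, ha, hb]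
    | neg a _ ha => rw [neg_mul, mul_neg, ha]
    | inv a _ ha => exact (Commute.inv_left₀ (show Commute a y from ha)).eq
    | mul a b _ _ ha hb => exact (Commute.mul_left (show Commute a y from ha) hb).eq
  intro x hx y hy
  refine step s y (fun z hz => ?_) x hx
  exact (step s z (fun u hu => hs u hu z hz) y hy).symm

theorem descend_span {F D K : Type*} [Field F] [DivisionRing D] [Algebra F D]
    [Field K] [Algebra F K] (x : D) (S : Submodule F D)
    {m : ℕ} (s : Fin m → D) (hs : ∀ i, s i ∈ S) (c : Fin m → K)
    (h : (1 ⊗ₜ x : K ⊗[F] D) = ∑ i, c i • (1 ⊗ₜ s i)) : x ∈ S := by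
  by_contra hx
  obtain ⟨f, hf, hS⟩ := Submodule.exists_le_ker_of_notMem hx
  have h2 := congrArg (TensorProduct.AlgebraTensorModule.rid F K K ∘ (f.baseChange K)) h
  simp only [Function.comp_apply, map_sum, map_smul, LinearMap.baseChange_tmul] at h2
  have h0 : ∀ i, f (s i) = 0 := fun i => hS (hs i)
  simp [h0] at h2
  exact hf h2

/-- Letters: the matrix itself, or its adjugate for an inverse letter. -/
def letAdj {R X : Type*} [CommRing R] {m : ℕ} (G : X → Matrix (Fin m) (Fin m) R)
    (l : X × Bool) : Matrix (Fin m) (Fin m) R :=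
  if l.2 then G l.1 else (G l.1).adjugate

theorem letAdj_map {R S X : Type*} [CommRing R] [CommRing S] (f : R →+* S) {m : ℕ}
    (G : X → Matrix (Fin m) (Fin m) R) (L : List (X × Bool)) :
    f.mapMatrix (L.map (letAdj G)).prod =
      (L.map (letAdj fun i => f.mapMatrix (G i))).prod := by
  rw [map_list_prod, List.map_map]
  congr 1
  apply List.map_congr_left
  rintro ⟨i, c⟩ _
  cases c
  · simp only [Function.comp_apply, letAdj, Bool.false_eq_true, if_false]
    rw [RingHom.map_adjugate]
  · simp [letAdj]

theorem kry_map {R S : Type*} [CommRing R] [CommRing S] (f : R →+* S) {m : ℕ}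
    (A : Matrix (Fin m) (Fin m) R) (v : Fin m → R) :
    f.mapMatrix (kry A v) = kry (f.mapMatrix A) (fun i => f (v i)) := by
  ext i j
  simp only [kry, RingHom.mapMatrix_apply, Matrix.map_apply, Matrix.of_apply, Matrix.mulVec,
    dotProduct, map_sum, map_mul]
  rw [← RingHom.mapMatrix_apply, ← map_pow]
  rfl

/-- The polynomial quantity whose nonvanishing we need. -/
def kryQ {R : Type*} [CommRing R] {m n : ℕ} (L : List (Fin n × Bool))
    (G : Fin n → Matrix (Fin m) (Fin m) R) (v : Fin m → R) : R :=
  (∏ i, (G i).det) * (kry ((L.map (letAdj G)).prod) v).det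

theorem kryQ_map {R S : Type*} [CommRing R] [CommRing S] (f : R →+* S) {m n : ℕ}
    (L : List (Fin n × Bool)) (G : Fin n → Matrix (Fin m) (Fin m) R) (v : Fin m → R) :
    f (kryQ L G v) = kryQ L (fun i => f.mapMatrix (G i)) (fun i => f (v i)) := by
  unfold kryQ
  rw [map_mul, map_prod, RingHom.map_det, kry_map, letAdj_map]
  congr 1
  refine Finset.prod_congr rfl fun i _ => ?_
  rw [RingHom.map_det]

theorem kryQ_word {K : Type*} [Field K] {m n : ℕ} (w : FreeGroup (Fin n))
    (y : Fin n → (Matrix (Fin m) (Fin m) K)ˣ) (v : Fin m → K) :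
    kryQ w.toWord (fun i => (y i).val) v ≠ 0 ↔ (kry ((FreeGroup.lift y w).val) v).det ≠ 0 := by
  have hd : ∀ x, (y x).val.det ≠ 0 := fun x =>
    ((Matrix.isUnit_iff_isUnit_det _).1 (y x).isUnit).ne_zero
  obtain ⟨c, hc, e⟩ := word_scalar (K := K) y (letAdj fun i => (y i).val)
    (fun x => by simp [letAdj])
    (fun x => ⟨(y x).val.det, hd x, by
      rw [← Units.mul_right_inj (y x), mul_smul_comm, Units.mul_inv]
      simp [letAdj, Matrix.mul_adjugate]⟩) w.toWord
  unfold kryQ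
  rw [e, FreeGroup.mk_toWord, mul_ne_zero_iff, kry_smul _ _ _ hc]
  exact and_iff_right (Finset.prod_ne_zero_iff.2 fun i _ => hd i)

theorem exists_poly {K ι : Type*} [Field K] [Fintype ι] {m n : ℕ} (L : List (Fin n × Bool))
    (B : ι → Matrix (Fin m) (Fin m) K) (v : Fin m → K) :
    ∃ P : MvPolynomial (Fin n × ι) K, ∀ p, MvPolynomial.eval p P =
      kryQ L (fun i => ∑ k, p (i, k) • B k) v := by
  refine ⟨kryQ L (fun i => ∑ k : ι, (MvPolynomial.X (i, k) : MvPolynomial (Fin n × ι) K) •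
    (B k).map MvPolynomial.C) (fun i => MvPolynomial.C (v i)), fun p => ?_⟩
  rw [kryQ_map]
  congr 1
  · funext i
    ext a c
    simp [Matrix.sum_apply]
  · funext i
    simp

theorem generic_point {F K ι : Type*} [Field F] [Infinite F] [Field K] [Algebra F K] [Fintype ι]
    {n N : ℕ} (w : FreeGroup (Fin n))
    (B : Module.Basis ι K (Matrix (Fin (N + 1)) (Fin (N + 1)) K))
    (g : Fin n → (Matrix (Fin (N + 1)) (Fin (N + 1)) K)ˣ) (v : Fin (N + 1) → K)
    (hgv : (kry ((FreeGroup.lift g w).val) v).det ≠ 0) :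
    ∃ (p : Fin n × ι → F), (∀ i, (∑ k, algebraMap F K (p (i, k)) • B k).det ≠ 0) ∧
      ∀ y : Fin n → (Matrix (Fin (N + 1)) (Fin (N + 1)) K)ˣ,
        (∀ i, (y i).val = ∑ k, algebraMap F K (p (i, k)) • B k) →
        (kry ((FreeGroup.lift y w).val) v).det ≠ 0 := by
  obtain ⟨P, hP⟩ := exists_poly w.toWord (fun k => B k) v
  have hP0 : P ≠ 0 := by
    intro h0
    have h := hP fun ik => B.repr (g ik.1).val ik.2
    rw [h0, map_zero] at h
    have e : (fun i => ∑ k, B.repr (g i).val k • B k) = fun i => (g i).val :=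
      funext fun i => B.sum_repr (g i).val
    rw [e] at h
    exact (kryQ_word w g v).2 hgv h.symm
  obtain ⟨p, hp⟩ : ∃ p : Fin n × ι → F,
      MvPolynomial.eval (fun k => algebraMap F K (p k)) P ≠ 0 := by
    by_contra! h
    apply hP0
    refine MvPolynomial.funext_set (fun _ => Set.range (algebraMap F K))
      (fun _ => Set.infinite_range_of_injective (algebraMap F K).injective) fun x hx => ?_
    choose q hq using fun i => hx i (Set.mem_univ i)
    rw [map_zero, ← h q]
    congr 2
    exact (funext hq).symm
  rw [hP] at hp
  refine ⟨p, fun i => ?_, fun y hy => ?_⟩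
  · have hp1 := (mul_ne_zero_iff.1 hp).1
    rw [Finset.prod_ne_zero_iff] at hp1
    exact hp1 i (Finset.mem_univ i)
  · rw [← kryQ_word]
    rw [show (fun i => (y i).val) = fun i => ∑ k, algebraMap F K (p (i, k)) • B k from funext hy]
    exact hp

theorem nonfinite_aux
    {F D K : Type*} [Field F] [DivisionRing D] [Algebra F D] [Infinite F]
    [FiniteDimensional F D] [Field K] [Algebra F K] [IsAlgClosed K]
    {N : ℕ} (E : K ⊗[F] D ≃ₐ[K] Matrix (Fin (N + 1)) (Fin (N + 1)) K)
    {n : ℕ} (w : FreeGroup (Fin n)) (hw : w ≠ 1) :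
    ∃ cs : Fin n → Dˣ, ∀ x : D, x * ((FreeGroup.lift cs w : Dˣ) : D) =
        ((FreeGroup.lift cs w : Dˣ) : D) * x →
      x ∈ Submodule.span F (Set.range fun k : ℕ => ((FreeGroup.lift cs w : Dˣ) : D) ^ k) := by
  obtain ⟨g, v, hgv⟩ := exists_glm (K := K) w hw N
  obtain ⟨φ, hφ⟩ : ∃ φ : D →+* Matrix (Fin (N + 1)) (Fin (N + 1)) K, ∀ d, φ d = E (1 ⊗ₜ d) :=
    ⟨(E : K ⊗[F] D →+* _).comp
      ((Algebra.TensorProduct.includeRight : D →ₐ[F] K ⊗[F] D) : D →+* K ⊗[F] D), fun d => rfl⟩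
  let b := Module.finBasis F D
  obtain ⟨B, hB⟩ : ∃ B : Module.Basis (Fin (Module.finrank F D)) K
      (Matrix (Fin (N + 1)) (Fin (N + 1)) K), ∀ i, B i = φ (b i) :=
    ⟨(b.baseChange K).map E.toLinearEquiv, fun i => by simp [hφ]⟩
  obtain ⟨p, hp1, hp2⟩ := generic_point (F := F) w B g v hgv
  let c : Fin n → D := fun i => ∑ k, p (i, k) • b k
  have hc : ∀ i, φ (c i) = ∑ k, algebraMap F K (p (i, k)) • B k := by
    intro i
    simp only [c, map_sum, hB]
    refine Finset.sum_congr rfl fun k _ => ?_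
    rw [hφ, hφ, ← map_smul E, TensorProduct.tmul_smul, algebraMap_smul]
  have hc0 : ∀ i, c i ≠ 0 := by
    intro i h
    apply hp1 i
    rw [← hc, h, map_zero, Matrix.det_zero]
  obtain ⟨cs, hcs⟩ : ∃ cs : Fin n → Dˣ, ∀ i, (cs i).val = c i :=
    ⟨fun i => Units.mk0 (c i) (hc0 i), fun i => rfl⟩
  refine ⟨cs, fun x hx => ?_⟩
  have hlift : (FreeGroup.lift (fun i => Units.map φ.toMonoidHom (cs i)) w).val =
      φ (FreeGroup.lift cs w).val := by
    have : FreeGroup.lift (fun i => Units.map φ.toMonoidHom (cs i)) =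
      (Units.map φ.toMonoidHom).comp (FreeGroup.lift cs) := by ext; simp
    rw [this]; rfl
  have hk := hp2 (fun i => Units.map φ.toMonoidHom (cs i)) (fun i => by
    rw [← hc, ← hcs]; rfl)
  rw [hlift] at hk
  generalize (FreeGroup.lift cs w).val = a at *
  obtain ⟨t, ht⟩ := kry_comm _ _ hk (φ x) (by rw [← map_mul, hx, map_mul])
  refine descend_span (K := K) x _ (fun j : Fin (N + 1) => a ^ (j : ℕ))
    (fun j => Submodule.subset_span ⟨j, rfl⟩) t ?_
  apply E.injective
  rw [map_sum]
  simp only [map_smul, ← hφ, map_pow]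
  exact ht

theorem nonfinite_case
    {F D : Type*} [Field F] [DivisionRing D] [Algebra F D] [Infinite F]
    (hcenter : Set.range (algebraMap F D) = Set.center D)
    [FiniteDimensional F D]
    {n : ℕ} (w : FreeGroup (Fin n)) (hw : w ≠ 1) :
    ∃ cs : Fin n → Dˣ, ∀ x : D, x * ((FreeGroup.lift cs w : Dˣ) : D) =
        ((FreeGroup.lift cs w : Dˣ) : D) * x →
      x ∈ Submodule.span F (Set.range fun k : ℕ => ((FreeGroup.lift cs w : Dˣ) : D) ^ k) := by
  have : IsSimpleRing (AlgebraicClosure F ⊗[F] D) := tensor_simple_aux hcenter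
  obtain ⟨m, hm, ⟨E⟩⟩ := IsSimpleRing.exists_algEquiv_matrix_of_isAlgClosed
    (AlgebraicClosure F) (AlgebraicClosure F ⊗[F] D)
  obtain ⟨N, rfl⟩ := Nat.exists_eq_succ_of_ne_zero hm.out
  exact nonfinite_aux E w hw

theorem maximal_subfield_of_word
    {F D : Type*} [Field F] [DivisionRing D] [Algebra F D]
    (hcenter : Set.range (algebraMap F D) = Set.center D)
    [FiniteDimensional F D]
    {n : ℕ} (w : FreeGroup (Fin n)) (hw : w ≠ 1) :
    ∃ cs : Fin n → Dˣ,
      IsMaximalSubfield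
        (Subfield.closure
          (Set.range (algebraMap F D) ∪ {((FreeGroup.lift cs w : Dˣ) : D)})) := by
  have hcent : ∀ x ∈ Set.range (algebraMap F D), ∀ y : D, x * y = y * x := by
    rintro x ⟨r, rfl⟩ y
    exact Algebra.commutes r y
  have hcomm : ∀ a : D, ∀ x ∈ Set.range (algebraMap F D) ∪ {a},
      ∀ y ∈ Set.range (algebraMap F D) ∪ {a}, x * y = y * x := by
    intro a x hx y hy
    rcases hx with hx | rfl
    · exact hcent x hx y
    · rcases hy with hy | rfl
      · exact (hcent y hy x).symm
      · rfl
  suffices h : ∃ cs : Fin n → Dˣ, ∀ x : D, x * ((FreeGroup.lift cs w : Dˣ) : D) =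
        ((FreeGroup.lift cs w : Dˣ) : D) * x → x ∈ Subfield.closure
          (Set.range (algebraMap F D) ∪ {((FreeGroup.lift cs w : Dˣ) : D)}) by
    obtain ⟨cs, h⟩ := h
    refine ⟨cs, closure_comm _ (hcomm _), fun L hL hle => le_antisymm hle fun x hx => h x ?_⟩
    exact hL x hx _ (hle (Subfield.subset_closure (Or.inr rfl)))
  rcases finite_or_infinite F with hF | hF
  · have : Finite D := Module.finite_of_finite F
    refine ⟨fun _ => 1, fun x _ => Subfield.subset_closure (Or.inl ?_)⟩
    rw [hcenter, Semigroup.mem_center_iff]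
    intro y
    exact (littleWedderburn D).mul_comm y x
  · obtain ⟨cs, h⟩ := nonfinite_case hcenter w hw
    refine ⟨cs, fun x hx => ?_⟩
    refine Submodule.span_induction (p := fun y _ => y ∈ Subfield.closure
      (Set.range (algebraMap F D) ∪ {((FreeGroup.lift cs w : Dˣ) : D)})) ?_ (zero_mem _) (fun _ _ _ _ => add_mem) ?_ (h x hx)
    · rintro _ ⟨k, rfl⟩
      change ((FreeGroup.lift cs w : Dˣ) : D) ^ k ∈ Subfield.closure (Set.range (algebraMap F D) ∪ {((FreeGroup.lift cs w : Dˣ) : D)})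
      have hmem : ((FreeGroup.lift cs w : Dˣ) : D) ∈ Subfield.closure
          (Set.range (algebraMap F D) ∪ {((FreeGroup.lift cs w : Dˣ) : D)}) :=
        Subfield.subset_closure (Or.inr rfl)
      exact pow_mem hmem k
    · intro r y _ hy
      rw [Algebra.smul_def]
      exact mul_mem (Subfield.subset_closure (Or.inl ⟨r, rfl⟩)) hy
end

section
/- Let D be a division ring whose center F is infinite, let w(x_1,…,x_m) be a non-trivial group word, and let d be a positive integer. If for all invertible a_1,…,a_m ∈ D the value w(a_1,…,a_m) is algebraic over F of degree at most d, then dim_F D ≤ d². -/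
namespace WordAlg
open PowerSeries

section Basic
variable {B B' : Type*} [Ring B] [Ring B']

/-- The unit `1 + b X` of the power series ring over `B`. -/
noncomputable def pu (b : B) : (B⟦X⟧)ˣ where
  val := 1 + C b * X
  inv := invOfUnit (1 + C b * X) 1
  val_inv := mul_invOfUnit _ _ (by simp)
  inv_val := invOfUnit_mul _ _ (by simp)

@[simp] lemma pu_val (b : B) : ((pu b : (B⟦X⟧)ˣ) : B⟦X⟧) = 1 + C b * X := rfl

/-- The Capelli type expression. -/
def cap {n : ℕ} (x c c' : Fin n → B) : B :=
  ∑ σ : Equiv.Perm (Fin n), Equiv.Perm.sign σ • (List.ofFn fun j => c j * x (σ j) * c' j).prod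

lemma map_cap {n : ℕ} (φ : B →+* B') (x c c' : Fin n → B) :
    φ (cap x c c') = cap (φ ∘ x) (φ ∘ c) (φ ∘ c') := by
  simp only [cap, map_sum, Units.smul_def, map_zsmul, map_list_prod, List.map_ofFn]
  refine Finset.sum_congr rfl fun σ _ => ?_
  congr 3
  funext j
  simp

lemma cap_mem {n : ℕ} (S : Subring B) (x c c' : Fin n → B) (hx : ∀ i, x i ∈ S)
    (hc : ∀ i, c i ∈ S) (hc' : ∀ i, c' i ∈ S) : cap x c c' ∈ S := by
  refine S.sum_mem fun σ _ => ?_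
  rw [Units.smul_def]
  refine S.zsmul_mem (S.list_prod_mem fun y hy => ?_) _
  rw [List.mem_ofFn] at hy
  obtain ⟨j, rfl⟩ := hy
  exact S.mul_mem (S.mul_mem (hc _) (hx _)) (hc' _)

lemma cap_eq_zero {F : Type*} [Field F] [Algebra F B] {n : ℕ} (x c c' : Fin n → B)
    (h : ¬ LinearIndependent F x) : cap x c c' = 0 := by
  have := (MultilinearMap.alternatization ((MultilinearMap.mkPiAlgebraFin F n B).compLinearMap
    (fun j => (LinearMap.mulRight F (c' j)).comp (LinearMap.mulLeft F (c j))))).map_linearDependent x h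
  rw [MultilinearMap.alternatization_apply] at this
  simpa [cap] using this

variable {m : ℕ} (w : FreeGroup (Fin m))

/-- The value of the word at `(1 + b X)(1 + b' X)`. -/
noncomputable def wv (b b' : Fin m → B) : (B⟦X⟧)ˣ := FreeGroup.lift (fun i => pu (b i) * pu (b' i)) w

lemma map_pu (φ : B →+* B') (b : B) :
    Units.map (PowerSeries.map φ : B⟦X⟧ →* B'⟦X⟧) (pu b) = pu (φ b) := by
  ext1; simp

lemma map_lift {G H : Type*} [Group G] [Group H] (f : G →* H) (a : Fin m → G) :
    f (FreeGroup.lift a w) = FreeGroup.lift (f ∘ a) w := by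
  have : f.comp (FreeGroup.lift a) = FreeGroup.lift (f ∘ a) := by
    ext; simp
  exact DFunLike.congr_fun this w

lemma map_wv (φ : B →+* B') (b b' : Fin m → B) :
    Units.map (PowerSeries.map φ : B⟦X⟧ →* B'⟦X⟧) (wv w b b') = wv w (φ ∘ b) (φ ∘ b') := by
  rw [wv, map_lift, wv]
  congr 2
  funext i
  simp [map_pu]

variable (d : ℕ)

/-- Capelli expression of the powers of the word value. -/
noncomputable def ex (b b' : Fin m → B) (c c' : Fin (d+1) → B) : B⟦X⟧ :=
  cap (fun i : Fin (d+1) => ((wv w b b' : (B⟦X⟧)ˣ) : B⟦X⟧) ^ (i : ℕ)) (fun i => C (c i)) (fun i => C (c' i))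

lemma map_ex (φ : B →+* B') (b b' : Fin m → B) (c c' : Fin (d+1) → B) :
    PowerSeries.map φ (ex w d b b' c c') = ex w d (φ ∘ b) (φ ∘ b') (φ ∘ c) (φ ∘ c') := by
  rw [ex, map_cap, ex]
  congr 1
  · funext i
    have := congrArg Units.val (map_wv w φ b b')
    simp only [Units.coe_map] at this
    simp [← this]
  · funext i; simp
  · funext i; simp

/-- The formal power series identity in the ring `B`. -/
def PI (B : Type*) [Ring B] : Prop :=
  ∀ (b b' : Fin m → B) (c c' : Fin (d+1) → B), ex w d b b' c c' = 0

lemma PI.of_surjective (φ : B →+* B') (hφ : Function.Surjective φ) (h : PI w d B) : PI w d B' := by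
  intro b b' c c'
  obtain ⟨b, rfl⟩ := hφ.comp_left b
  obtain ⟨b', rfl⟩ := hφ.comp_left b'
  obtain ⟨c, rfl⟩ := hφ.comp_left c
  obtain ⟨c', rfl⟩ := hφ.comp_left c'
  rw [← map_ex, h, map_zero]

lemma PI.of_jointly_injective {κ : Type*} (φ : κ → B →+* B')
    (hφ : ∀ x, (∀ k, φ k x = 0) → x = 0) (h : PI w d B') : PI w d B := by
  intro b b' c c'
  ext n
  refine hφ _ fun k => ?_
  have := congrArg (PowerSeries.coeff n) (map_ex w d (φ k) b b' c c')
  rw [h] at this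
  simpa using this

end Basic

section Tensor
open scoped TensorProduct
variable {F D : Type*} [Field F] [Infinite F] [Ring D] [Algebra F D]
variable {m : ℕ} (w : FreeGroup (Fin m)) (d : ℕ)

lemma PI.mvPolynomial {σ : Type*} (h : PI w d D) : PI w d (MvPolynomial σ F ⊗[F] D) := by
  let ev (y : σ → F) : MvPolynomial σ F ⊗[F] D →ₐ[F] D :=
    Algebra.TensorProduct.lift ((Algebra.ofId F D).comp (MvPolynomial.aeval y)) (AlgHom.id F D)
      (fun a b => Algebra.commutes _ _)
  refine PI.of_jointly_injective w d (fun y => (ev y).toRingHom) (fun x hx => ?_) h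
  let bD := Module.Free.chooseBasis F D
  let bb := Algebra.TensorProduct.basis (MvPolynomial σ F) bD
  have key : ∀ y (x : MvPolynomial σ F ⊗[F] D) i,
      bD.repr (ev y x) i = MvPolynomial.eval y (bb.repr x i) := by
    intro y x i
    induction x with
    | zero => simp
    | add a b ha hb => simp [ha, hb]
    | tmul p z =>
      have h1 : ev y (p ⊗ₜ[F] z) = MvPolynomial.eval y p • z := by
        rw [Algebra.smul_def]
        exact Algebra.TensorProduct.lift_tmul _ _ _ _ _
      rw [h1]
      simp [bb]
  refine bb.repr.injective ?_
  ext1 i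
  refine MvPolynomial.funext fun y => ?_
  rw [← key]
  have := hx y
  simp at this
  simp [this]

lemma PI.tensor (L : Type*) [CommRing L] [Algebra F L] (h : PI w d D) : PI w d (L ⊗[F] D) := by
  refine PI.of_surjective w d (Algebra.TensorProduct.map
    (MvPolynomial.aeval (R := F) (id : L → L)) (AlgHom.id F D)).toRingHom ?_
    (PI.mvPolynomial (F := F) (σ := L) w d h)
  exact TensorProduct.map_surjective (g' := (LinearMap.id : D →ₗ[F] D))
    (g := (MvPolynomial.aeval (R := F) (id : L → L)).toLinearMap)
    (fun x => ⟨MvPolynomial.X x, by simp⟩) Function.surjective_id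

end Tensor
end WordAlg

namespace WordAlg
set_option linter.unusedSectionVars false
open Polynomial

section StepA
variable {F D : Type*} [Field F] [Infinite F] [DivisionRing D] [Algebra F D]

lemma ore_aux : ∀ (N : ℕ) (q p : D[X]), q ≠ 0 → q.natDegree ≤ N → ∃ r s : D[X], s ≠ 0 ∧ q * r = p * s := by
  intro N
  induction N using Nat.strong_induction_on with
  | _ N ih =>
  intro q p hq hN
  set q1 := q * C q.leadingCoeff⁻¹ with hq1
  have hm : q1.Monic := monic_mul_leadingCoeff_inv hq
  have hdeg : q1.degree = q.degree := degree_mul_leadingCoeff_inv q hq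
  have hdiv := modByMonic_add_div p q1
  by_cases h0 : p %ₘ q1 = 0
  · refine ⟨C q.leadingCoeff⁻¹ * (p /ₘ q1), 1, one_ne_zero, ?_⟩
    rw [h0, zero_add] at hdiv
    rw [← mul_assoc, ← hq1, hdiv, mul_one]
  · have hlt : (p %ₘ q1).natDegree < N := by
      have := natDegree_lt_natDegree h0 (degree_modByMonic_lt p hm)
      rw [natDegree_eq_of_degree_eq hdeg] at this
      omega
    obtain ⟨r, s, hs, hrs⟩ := ih _ hlt (p %ₘ q1) q h0 le_rfl
    have hr : r ≠ 0 := by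
      rintro rfl
      rw [mul_zero] at hrs
      exact mul_ne_zero hq hs hrs.symm
    refine ⟨s + C q.leadingCoeff⁻¹ * (p /ₘ q1) * r, r, hr, ?_⟩
    conv_rhs => rw [← hdiv]
    rw [add_mul, hrs, mul_add, hq1]
    simp only [mul_assoc]

lemma ore (q p : D[X]) (hq : q ≠ 0) : ∃ r s : D[X], s ≠ 0 ∧ q * r = p * s :=
  ore_aux _ q p hq le_rfl

/-- Evaluation at a central element. -/
noncomputable def evc (l : F) : D[X] →+* D :=
  eval₂RingHom' (RingHom.id D) (algebraMap F D l) (fun a => (Algebra.commutes l a).symm)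

lemma evc_eq (l : F) (p : D[X]) : evc l p = p.sum fun i a => a * algebraMap F D l ^ i := by
  change eval₂ (RingHom.id D) (algebraMap F D l) p = _
  rw [eval₂_eq_sum]
  rfl

lemma evc_C (l : F) (a : D) : evc l (C a) = a := eval₂_C _ _

lemma evc_X (l : F) : evc l (X : D[X]) = algebraMap F D l := eval₂_X _ _

lemma eq_zero_of_evc (p : D[X]) (h : ∀ᶠ l : F in Filter.cofinite, evc l p = 0) : p = 0 := by
  ext n
  rw [coeff_zero, ← Module.forall_dual_apply_eq_zero_iff F]
  intro φ
  let P : F[X] := ∑ i ∈ p.support, C (φ (p.coeff i)) * X ^ i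
  have hP : ∀ l, P.eval l = φ (evc l p) := by
    intro l
    simp only [P, eval_finsetSum, evc_eq, Polynomial.sum, map_sum]
    refine Finset.sum_congr rfl fun i _ => ?_
    rw [← map_pow, ← Algebra.commutes, ← Algebra.smul_def]
    rw [eval_mul, eval_C, eval_pow, eval_X, map_smul, smul_eq_mul, mul_comm]
  have hP0 : P = 0 := by
    refine Polynomial.eq_zero_of_infinite_isRoot P ?_
    refine Set.Infinite.mono (s := {l | evc l p = 0}) ?_ ?_
    · intro l hl
      simp only [Set.mem_ofPred_eq] at hl ⊢
      simp [IsRoot, hP, hl]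
    · intro hfin
      have : (Set.univ : Set F).Finite := by
        rw [← Set.union_compl_self {l | evc l p = 0}]
        exact hfin.union h
      exact Set.infinite_univ this
  have := congrArg (fun P => P.coeff n) hP0
  simp only [P, finsetSum_coeff, coeff_C_mul, coeff_X_pow, coeff_zero, mul_ite, mul_one, mul_zero] at this
  by_cases hn : n ∈ p.support
  · simpa [Finset.sum_ite_eq, hn] using this
  · simp [notMem_support_iff.mp hn]

variable (F D) in
/-- Pairs of a power series and a function that represent the same rational function. -/
noncomputable def ratPair : Subring (PowerSeries D × (F → D)) where
  carrier := {x | ∃ p q : D[X], q ≠ 0 ∧ x.1 * (q : PowerSeries D) = p ∧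
    ∀ᶠ l : F in Filter.cofinite, x.2 l * evc l q = evc l p}
  mul_mem' := by
    rintro ⟨f1, g1⟩ ⟨f2, g2⟩ ⟨p1, q1, h1, e1, a1⟩ ⟨p2, q2, h2, e2, a2⟩
    obtain ⟨r, s, hs, hrs⟩ := ore q1 p2 h1
    refine ⟨p1 * r, q2 * s, mul_ne_zero h2 hs, ?_, ?_⟩
    · simp only at e1 e2
      simp only [Prod.mk_mul_mk, coe_mul]
      rw [mul_assoc, ← mul_assoc f2, e2, ← coe_mul, ← hrs, coe_mul, ← mul_assoc, e1]
    · filter_upwards [a1, a2] with l a1 a2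
      simp only [Prod.mk_mul_mk, map_mul, Pi.mul_apply]
      rw [mul_assoc, ← mul_assoc (g2 l), a2, ← map_mul, ← hrs, map_mul, ← mul_assoc, a1]
  one_mem' := ⟨1, 1, one_ne_zero, by simp, by simp⟩
  add_mem' := by
    rintro ⟨f1, g1⟩ ⟨f2, g2⟩ ⟨p1, q1, h1, e1, a1⟩ ⟨p2, q2, h2, e2, a2⟩
    obtain ⟨r, s, hs, hrs⟩ := ore q1 q2 h1
    refine ⟨p1 * r + p2 * s, q2 * s, mul_ne_zero h2 hs, ?_, ?_⟩
    · simp only at e1 e2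
      simp only [Prod.mk_add_mk, coe_mul, coe_add, add_mul]
      rw [← mul_assoc f2, e2, ← coe_mul q2, ← hrs, coe_mul, ← mul_assoc, e1]
    · filter_upwards [a1, a2] with l a1 a2
      simp only [Prod.mk_add_mk, map_mul, Pi.add_apply, map_add, add_mul]
      rw [← mul_assoc (g2 l), a2, ← map_mul (evc l) q2, ← hrs, map_mul, ← mul_assoc, a1]
  zero_mem' := ⟨0, 1, one_ne_zero, by simp, by simp⟩
  neg_mem' := by
    rintro ⟨f1, g1⟩ ⟨p1, q1, h1, e1, a1⟩
    refine ⟨-p1, q1, h1, ?_, ?_⟩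
    · simp only at e1
      rw [Prod.neg_mk, neg_mul, e1]
      exact ((Polynomial.coeToPowerSeries.ringHom (R := D)).map_neg p1).symm
    · filter_upwards [a1] with l a1
      simpa using a1

lemma ratPair_zero (f : PowerSeries D) (g : F → D) (h : (f, g) ∈ ratPair F D) (hg : ∀ l, g l = 0) :
    f = 0 := by
  obtain ⟨p, q, hq, e, a⟩ := h
  have hp : p = 0 := by
    refine eq_zero_of_evc (F := F) p ?_
    filter_upwards [a] with l a
    simpa [hg] using a.symm
  subst hp
  simp only [coe_zero] at e
  rcases mul_eq_zero.mp e with h | h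
  · exact h
  · exact absurd (by simpa using h) hq

open Classical in
/-- The function part of the unit `1 + b X`. -/
noncomputable def fu (b : D) (l : F) : Dˣ :=
  if h : 1 + b * algebraMap F D l = 0 then 1 else Units.mk0 _ h

/-- The pair unit of `1 + b X`. -/
noncomputable def ppu (b : D) : (PowerSeries D × (F → D))ˣ :=
  MulEquiv.prodUnits.symm (pu b, MulEquiv.piUnits.symm (fu b))

lemma ppu_fst (b : D) : ((ppu b : (PowerSeries D × (F → D))ˣ) : PowerSeries D × (F → D)).1 = (pu b : (PowerSeries D)ˣ) := rfl

lemma fu_ae (b : D) : ∀ᶠ l : F in Filter.cofinite, ((fu b l : Dˣ) : D) = 1 + b * algebraMap F D l := by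
  have : {l : F | ¬ (((fu b l : Dˣ) : D) = 1 + b * algebraMap F D l)} ⊆ {l | 1 + b * algebraMap F D l = 0} := by
    intro l hl
    by_contra h
    simp only [Set.mem_ofPred_eq] at h
    exact hl (by simp [fu, h])
  refine Set.Finite.subset (Set.Subsingleton.finite ?_) this
  intro x hx y hy
  simp only [Set.mem_ofPred_eq] at hx hy
  have hb : b ≠ 0 := by rintro rfl; simp at hx
  have := add_left_cancel (hx.trans hy.symm)
  exact (algebraMap F D).injective (mul_left_cancel₀ hb this)

lemma ppu_mem (b : D) : ppu b ∈ (ratPair F D).toSubmonoid.units := by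
  have ev : ∀ l : F, evc l (1 + C b * X) = 1 + b * algebraMap F D l := by
    intro l
    rw [map_add, map_one, map_mul, evc_C, evc_X]
  rw [Submonoid.mem_units_iff]
  constructor
  · refine ⟨1 + C b * X, 1, one_ne_zero, ?_, ?_⟩
    · simp only [coe_one, mul_one, ppu_fst, pu_val, coe_add, coe_mul, coe_C, coe_X]
    · filter_upwards [fu_ae b] with l hl
      rw [ev, ← hl]
      rw [map_one, mul_one]; rfl
  · refine ⟨1, 1 + C b * X, ?_, ?_, ?_⟩
    · intro h
      have := congrArg (fun p => p.coeff 0) h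
      simp at this
    · have : (((1 + C b * X : D[X])) : PowerSeries D) = (pu b : (PowerSeries D)ˣ) := by simp
      rw [this, coe_one]
      exact Units.inv_mul (pu b)
    · filter_upwards [fu_ae b] with l hl
      rw [ev, ← hl, map_one]
      exact Units.inv_mul _

variable {m : ℕ} (w : FreeGroup (Fin m)) (d : ℕ)

lemma PI.of_alg (halg : ∀ a : Fin m → Dˣ,
      ∃ p : Polynomial F, p ≠ 0 ∧ p.natDegree ≤ d ∧
        Polynomial.aeval ((FreeGroup.lift a w : Dˣ) : D) p = 0) : PI w d D := by
  intro b b' c c'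
  let M := PowerSeries D × (F → D)
  let U : Mˣ := FreeGroup.lift (fun i => (ppu (b i) * ppu (b' i) : Mˣ)) w
  have hU : U ∈ (ratPair F D).toSubmonoid.units := by
    have : FreeGroup.lift (fun i => (ppu (b i) * ppu (b' i) : Mˣ)) w ∈
      (FreeGroup.lift (fun i => (ppu (b i) * ppu (b' i) : Mˣ))).range := ⟨w, rfl⟩
    refine (?_ : (FreeGroup.lift (fun i => (ppu (b i) * ppu (b' i) : Mˣ))).range ≤ _) this
    rw [FreeGroup.range_lift_eq_closure, Subgroup.closure_le]
    rintro _ ⟨i, rfl⟩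
    exact Subgroup.mul_mem _ (ppu_mem _) (ppu_mem _)
  have hU' : (U : M) ∈ ratPair F D := (Submonoid.mem_units_iff _ _ |>.mp hU).1
  let cc : D → M := fun c => (PowerSeries.C c, fun _ => c)
  have hcc : ∀ c, cc c ∈ ratPair F D := fun c => ⟨C c, 1, one_ne_zero, by simp [cc], by simp [cc, evc_C]⟩
  have hmem := cap_mem (ratPair F D) (fun i : Fin (d+1) => (U : M) ^ (i : ℕ)) (fun i => cc (c i))
    (fun i => cc (c' i)) (fun i => Subring.pow_mem _ hU' _) (fun i => hcc _) (fun i => hcc _)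
  have hfst : (cap (fun i : Fin (d+1) => (U : M) ^ (i : ℕ)) (fun i => cc (c i))
    (fun i => cc (c' i))).1 = ex w d b b' c c' := by
    have h1 := map_cap (RingHom.fst (PowerSeries D) (F → D)) (fun i : Fin (d+1) => (U : M) ^ (i : ℕ))
      (fun i => cc (c i)) (fun i => cc (c' i))
    refine h1.trans ?_
    have h2 : Units.map (RingHom.fst (PowerSeries D) (F → D) : M →* PowerSeries D) U = wv w b b' := by
      rw [map_lift, wv]
      congr 2
    have h3 := congrArg Units.val h2
    rw [ex, ← h3]
    congr 1
  have hsnd : ∀ l, (cap (fun i : Fin (d+1) => (U : M) ^ (i : ℕ)) (fun i => cc (c i))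
    (fun i => cc (c' i))).2 l = 0 := by
    intro l
    let φ : M →+* D := (Pi.evalRingHom (fun _ : F => D) l).comp (RingHom.snd (PowerSeries D) (F → D))
    have h1 := map_cap φ (fun i : Fin (d+1) => (U : M) ^ (i : ℕ)) (fun i => cc (c i)) (fun i => cc (c' i))
    refine h1.trans (cap_eq_zero (F := F) _ _ _ ?_)
    have h2 := map_lift w (Units.map (φ : M →* D)) (fun i => (ppu (b i) * ppu (b' i) : Mˣ))
    obtain ⟨p, hp, hpd, hpe⟩ := halg (Units.map (φ : M →* D) ∘ (fun i => (ppu (b i) * ppu (b' i) : Mˣ)))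
    rw [← h2] at hpe
    rw [Fintype.not_linearIndependent_iff]
    refine ⟨fun i => p.coeff i, ?_, ?_⟩
    · rw [aeval_eq_sum_range' (Nat.lt_succ_of_le hpd)] at hpe
      rw [Finset.sum_range] at hpe
      rw [← hpe]
      refine Finset.sum_congr rfl fun i _ => ?_
      simp [U]
    · refine ⟨⟨p.natDegree, Nat.lt_succ_of_le hpd⟩, ?_⟩
      simpa using hp
  rw [← hfst]
  exact ratPair_zero (F := F) _ _ hmem hsnd

end StepA
end WordAlg

namespace WordAlg
set_option linter.style.haveILetI false
open scoped TensorProduct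

section Density
variable {m : ℕ} (w : FreeGroup (Fin m)) (d : ℕ)

lemma PI.matrix {F A V n : Type*} [Field F] [Ring A] [AddCommGroup V] [Module F V] [Module A V]
    [SMulCommClass A F V] [Fintype n] [DecidableEq n] (v : n → V) (hv : LinearIndependent F v)
    (hd : ∀ y : n → V, ∃ r : A, ∀ j, r • v j = y j) (h : PI w d A) : PI w d (Matrix n n F) := by
  let T : Subring (A × Matrix n n F) :=
    { carrier := {x | ∀ j, x.1 • v j = ∑ i, x.2 i j • v i}
      mul_mem' := by
        rintro ⟨a, M⟩ ⟨b, N⟩ ha hb j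
        have ha' : ∀ j, a • v j = ∑ i, M i j • v i := ha
        have hb' : ∀ j, b • v j = ∑ i, N i j • v i := hb
        simp only [Prod.mk_mul_mk, mul_smul, hb', Finset.smul_sum, Matrix.mul_apply, Finset.sum_smul]
        rw [Finset.sum_comm]
        refine Finset.sum_congr rfl fun k _ => ?_
        rw [smul_comm, ha', Finset.smul_sum]
        refine Finset.sum_congr rfl fun i _ => ?_
        rw [smul_smul, smul_smul, mul_comm]
      one_mem' := by
        intro j
        simp [Matrix.one_apply]
      add_mem' := by
        rintro ⟨a, M⟩ ⟨b, N⟩ ha hb j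
        have ha' : ∀ j, a • v j = ∑ i, M i j • v i := ha
        have hb' : ∀ j, b • v j = ∑ i, N i j • v i := hb
        simp [add_smul, ha', hb', Finset.sum_add_distrib]
      zero_mem' := by
        intro j
        simp
      neg_mem' := by
        rintro ⟨a, M⟩ ha j
        have ha' : ∀ j, a • v j = ∑ i, M i j • v i := ha
        simp [ha'] }
  have hT : PI w d T := by
    refine PI.of_jointly_injective w d (fun _ : Unit => (RingHom.fst A (Matrix n n F)).comp T.subtype)
      ?_ h
    rintro ⟨⟨a, M⟩, hx⟩ h0
    have ha : a = 0 := h0 ()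
    subst ha
    have hx' : ∀ j, (0 : A) • v j = ∑ i, M i j • v i := hx
    have hM : M = 0 := by
      ext i j
      have := hx' j
      rw [zero_smul] at this
      exact Fintype.linearIndependent_iff.mp hv (fun i => M i j) this.symm i
    subst hM
    rfl
  refine PI.of_surjective w d ((RingHom.snd A (Matrix n n F)).comp T.subtype) ?_ hT
  intro M
  obtain ⟨r, hr⟩ := hd fun j => ∑ i, M i j • v i
  exact ⟨⟨(r, M), hr⟩, rfl⟩

variable {F D L : Type*} [Field F] [DivisionRing D] [Algebra F D] [Field L] [Algebra F L]
  (ι : L →ₐ[F] D) [Module L D] [IsScalarTower F L D]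

/-- The action of `L ⊗ D` on `D`. -/
noncomputable def rho (hsm : ∀ (l : L) (x : D), l • x = x * ι l) :
    L ⊗[F] D →ₐ[L] Module.End L D :=
  Algebra.TensorProduct.lift (Algebra.ofId L _)
    ({ toFun := fun a =>
        { toFun := fun x => a * x
          map_add' := mul_add a
          map_smul' := fun l x => by simp [hsm, mul_assoc] }
       map_one' := by ext; simp
       map_mul' := fun a b => by ext x; simp [mul_assoc]
       map_zero' := by ext; simp
       map_add' := fun a b => by ext x; simp [add_mul]
       commutes' := fun f => by ext x; simp [Algebra.smul_def] } : D →ₐ[F] Module.End L D)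
    (fun l a => Algebra.commutes l _)

lemma rho_tmul (hsm : ∀ (l : L) (x : D), l • x = x * ι l) (l : L) (a x : D) :
    rho ι hsm (l ⊗ₜ a) x = a * x * ι l := by
  have : rho ι hsm (l ⊗ₜ a) = _ := Algebra.TensorProduct.lift_tmul _ _ _ _ _
  rw [this, ← hsm]
  rfl

lemma density (hsm : ∀ (l : L) (x : D), l • x = x * ι l)
    (hmax : ∀ x : D, (∀ l, x * ι l = ι l * x) → ∃ l, ι l = x)
    {n : Type*} [Fintype n] (v : n → D) (hv : LinearIndependent L v) (y : n → D) :
    ∃ r : L ⊗[F] D, ∀ j, rho ι hsm r (v j) = y j := by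
  classical
  letI : Module (L ⊗[F] D) D := Module.compHom D (rho ι hsm).toRingHom
  have hact : ∀ (r : L ⊗[F] D) (x : D), r • x = rho ι hsm r x := fun _ _ => rfl
  have hsimple : IsSimpleModule (L ⊗[F] D) D := by
    rw [isSimpleModule_iff_toSpanSingleton_surjective]
    refine ⟨inferInstance, fun x hx z => ⟨1 ⊗ₜ (z * x⁻¹), ?_⟩⟩
    rw [LinearMap.toSpanSingleton_apply, hact, rho_tmul]
    simp [hx]
  have hE : ∀ e : Module.End (L ⊗[F] D) D, ∃ l : L, ∀ x, e x = l • x := by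
    intro e
    have h1 : ∀ x, e x = x * e 1 := by
      intro x
      have := e.map_smul (1 ⊗ₜ x) 1
      simpa [hact, rho_tmul] using this
    obtain ⟨l, hl⟩ := hmax (e 1) (fun l => by
      have := e.map_smul (l ⊗ₜ 1) 1
      rw [hact, hact, rho_tmul, rho_tmul] at this
      simp only [one_mul] at this
      rw [← this, h1])
    exact ⟨l, fun x => by rw [h1, hsm, hl]⟩
  obtain ⟨f, hf⟩ : ∃ f : D →ₗ[L] D, ∀ j, f (v j) = y j := by
    obtain ⟨f, hf⟩ := LinearMap.exists_extend ((Module.Basis.span hv).constr L y)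
    refine ⟨f, fun j => ?_⟩
    have := congrArg (fun g => g (Module.Basis.span hv j)) hf
    simp only [LinearMap.comp_apply, Module.Basis.constr_basis] at this
    rw [← this]
    congr 1
    rw [Submodule.subtype_apply, Module.Basis.span_apply]
  let f' : Module.End (Module.End (L ⊗[F] D) D) D :=
    { toFun := f
      map_add' := f.map_add
      map_smul' := fun e x => by
        obtain ⟨l, hl⟩ := hE e
        simp [Module.End.smul_def, hl] }
  obtain ⟨r, hr⟩ := jacobson_density f' (Finset.univ.image v)
  refine ⟨r, fun j => ?_⟩
  rw [← hact, ← hr (v j) (Finset.mem_image_of_mem _ (Finset.mem_univ _)), ← hf]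
  rfl

/-- Minimal length argument. -/
lemma coeff_zero_of_sum (hcenter : Set.range (algebraMap F D) = Set.center D) {κ : Type*} (e : κ → D)
    (he : LinearIndependent F e) : ∀ (s : Finset κ) (a : κ → D),
      (∀ x, ∑ i ∈ s, a i * x * e i = 0) → ∀ i ∈ s, a i = 0 := by
  classical
  intro s
  induction s using Finset.induction_on with
  | empty => simp
  | insert k s hk ih =>
    intro a ha
    have hzero : a k = 0 := by
      by_contra hne
      have hcomm : ∀ i ∈ s, ∀ y, (a k)⁻¹ * a i * y = y * ((a k)⁻¹ * a i) := by
        intro i hi y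
        rw [← sub_eq_zero]
        refine ih (fun i => (a k)⁻¹ * a i * y - y * ((a k)⁻¹ * a i)) (fun x => ?_) i hi
        have h1 := congrArg (fun z => (a k)⁻¹ * z) (ha (y * x))
        have h2 := congrArg (fun z => y * ((a k)⁻¹ * z)) (ha x)
        simp only [mul_zero, Finset.sum_insert hk, mul_add, Finset.mul_sum] at h1 h2
        have e1 : (a k)⁻¹ * (a k * (y * x) * e k) = y * x * e k := by
          simp only [← mul_assoc, inv_mul_cancel₀ hne, one_mul]
        have e2 : y * ((a k)⁻¹ * (a k * x * e k)) = y * x * e k := by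
          simp only [← mul_assoc, inv_mul_cancel_right₀ hne]
        rw [e1] at h1
        rw [e2] at h2
        have h3 := add_left_cancel (h1.trans h2.symm)
        rw [← sub_eq_zero, ← Finset.sum_sub_distrib] at h3
        rw [← h3]
        refine Finset.sum_congr rfl fun i _ => ?_
        simp only [sub_mul, mul_assoc]
      have hF : ∀ i ∈ s, ∃ f : F, algebraMap F D f = (a k)⁻¹ * a i := by
        intro i hi
        have : (a k)⁻¹ * a i ∈ Set.range (algebraMap F D) := by
          rw [hcenter, Semigroup.mem_center_iff]
          exact fun y => (hcomm i hi y).symm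
        exact this
      choose! f hf using hF
      have h1 := congrArg (fun z => (a k)⁻¹ * z) (ha 1)
      simp only [mul_zero, Finset.sum_insert hk, mul_add, Finset.mul_sum, mul_one] at h1
      have h2 : ∑ i ∈ insert k s, (if i = k then 1 else f i) • e i = 0 := by
        rw [Finset.sum_insert hk, ← h1]
        congr 1
        · rw [← mul_assoc, inv_mul_cancel₀ hne]; simp
        · refine Finset.sum_congr rfl fun i hi => ?_
          rw [if_neg (by rintro rfl; exact hk hi), Algebra.smul_def, hf i hi, mul_assoc]
      have h3 := linearIndependent_iff'.mp he _ _ h2 k (Finset.mem_insert_self _ _)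
      simp at h3
    intro i hi
    rcases Finset.mem_insert.mp hi with rfl | hi
    · exact hzero
    · refine ih a (fun x => ?_) i hi
      have := ha x
      rwa [Finset.sum_insert hk, hzero, zero_mul, zero_mul, zero_add] at this

lemma rho_injective (hcenter : Set.range (algebraMap F D) = Set.center D)
    (hsm : ∀ (l : L) (x : D), l • x = x * ι l) : Function.Injective (rho ι hsm) := by
  rw [injective_iff_map_eq_zero]
  intro r hr
  let bL := Module.Free.chooseBasis F L
  let bb := Algebra.TensorProduct.basis D bL
  let s : D ⊗[F] L := TensorProduct.comm F L D r
  have hs : r = TensorProduct.comm F D L s := by simp [s]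
  have hrep : s = ∑ i ∈ (bb.repr s).support, (bb.repr s i) ⊗ₜ bL i := by
    conv_lhs => rw [← bb.linearCombination_repr s, Finsupp.linearCombination_apply, Finsupp.sum]
    refine Finset.sum_congr rfl fun i _ => ?_
    rw [Algebra.TensorProduct.basis_apply, TensorProduct.smul_tmul', smul_eq_mul, mul_one]
  have hz := coeff_zero_of_sum hcenter (fun i => ι (bL i))
    (bL.linearIndependent.map' ι.toLinearMap (LinearMap.ker_eq_bot.mpr ι.toRingHom.injective))
    (bb.repr s).support (bb.repr s) (fun x => by
      have := congrArg (fun g => g x) hr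
      rw [hs, hrep, map_sum, map_sum] at this
      simpa [rho_tmul, LinearMap.sum_apply] using this)
  have : s = 0 := by
    rw [hrep]
    refine Finset.sum_eq_zero fun i hi => ?_
    rw [hz i hi, TensorProduct.zero_tmul]
  rw [hs, this, map_zero]

end Density

lemma exists_max {F D : Type*} [Field F] [DivisionRing D] [Algebra F D] :
    ∃ (L : Subalgebra F D), (∀ x ∈ L, ∀ y ∈ L, x * y = y * x) ∧
      ∀ x, (∀ y ∈ L, x * y = y * x) → x ∈ L := by
  obtain ⟨S, hS⟩ := zorn_subset {S : Set D | ∀ x ∈ S, ∀ y ∈ S, x * y = y * x} (by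
    intro c hc hch
    refine ⟨⋃₀ c, ?_, fun s hs => Set.subset_sUnion_of_mem hs⟩
    rintro x ⟨s, hs, hx⟩ y ⟨t, ht, hy⟩
    rcases hch.total hs ht with h | h
    · exact hc ht x (h hx) y hy
    · exact hc hs x hx y (h hy))
  have hprop : ∀ x ∈ S, ∀ y ∈ S, x * y = y * x := hS.prop
  have hmem : ∀ x, (∀ y ∈ S, y * x = x * y) → x ∈ S := by
    intro x hx
    have h1 : insert x S ∈ {S : Set D | ∀ x ∈ S, ∀ y ∈ S, x * y = y * x} := by
      rintro a (rfl | ha) b (rfl | hb)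
      · rfl
      · exact (hx b hb).symm
      · exact hx a ha
      · exact hprop a ha b hb
    exact hS.le_of_ge h1 (Set.subset_insert x S) (Set.mem_insert x S)
  have hL : ∀ x, x ∈ Subalgebra.centralizer F S ↔ x ∈ S := by
    intro x
    rw [Subalgebra.mem_centralizer_iff]
    exact ⟨hmem x, fun hx y hy => hprop y hy x hx⟩
  refine ⟨Subalgebra.centralizer F S, ?_, ?_⟩
  · intro x hx y hy
    exact hprop x ((hL x).1 hx) y ((hL y).1 hy)
  · intro x hx
    rw [hL]
    exact hmem x fun y hy => (hx y ((hL y).2 hy)).symm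

universe uD

lemma exists_max_field {F : Type*} {D : Type uD} [Field F] [DivisionRing D] [Algebra F D] :
    ∃ (L : Type uD) (_ : Field L) (_ : Algebra F L) (ι : L →ₐ[F] D),
      ∀ x : D, (∀ l, x * ι l = ι l * x) → ∃ l, ι l = x := by
  obtain ⟨L, hc, hm⟩ := exists_max (F := F) (D := D)
  letI : CommRing L := { (inferInstance : Ring L) with mul_comm := fun x y => Subtype.ext (hc x x.2 y y.2) }
  have hf : IsField L :=
    { exists_pair_ne := ⟨0, 1, zero_ne_one⟩
      mul_comm := mul_comm
      mul_inv_cancel := by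
        intro a ha
        have ha' : (a : D) ≠ 0 := fun h => ha (Subtype.ext h)
        refine ⟨⟨(a : D)⁻¹, hm _ fun y hy => ?_⟩, Subtype.ext (mul_inv_cancel₀ ha')⟩
        have : Commute (a : D) y := hc a a.2 y hy
        exact this.inv_left₀ }
  refine ⟨L, hf.toField, inferInstanceAs (Algebra F L), L.val, fun x hx => ?_⟩
  exact ⟨⟨x, hm x fun y hy => hx ⟨y, hy⟩⟩, rfl⟩

theorem main_of_matrix {F D : Type*} [Field F] [Infinite F] [DivisionRing D] [Algebra F D]
    (hcenter : Set.range (algebraMap F D) = Set.center D)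
    {m : ℕ} (w : FreeGroup (Fin m)) (d : ℕ) (h : PI w d D)
    (hmat : ∀ (n : Type) [Fintype n] [DecidableEq n], Fintype.card n = d + 1 → ¬ PI w d (Matrix n n F)) :
    Module.rank F D ≤ (d ^ 2 : ℕ) := by
  obtain ⟨L', iL, iA, ι, hmax⟩ := exists_max_field (F := F) (D := D)
  letI : Module L' D :=
    { smul := fun l x => x * ι l
      one_smul := fun x => by change x * ι 1 = x; simp
      mul_smul := fun a b x => by
        change x * ι (a * b) = x * ι b * ι a
        rw [mul_comm a b, map_mul, mul_assoc]
      smul_zero := fun a => zero_mul _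
      zero_smul := fun x => by change x * ι 0 = 0; simp
      smul_add := fun a x y => add_mul _ _ _
      add_smul := fun a b x => by
        change x * ι (a + b) = x * ι a + x * ι b
        rw [map_add, mul_add] }
  have hsm : ∀ (l : L') (x : D), l • x = x * ι l := fun _ _ => rfl
  haveI : IsScalarTower F L' D := ⟨fun f l x => by simp [hsm]⟩
  have hrank : Module.rank L' D ≤ d := by
    by_contra hlt
    rw [not_le] at hlt
    have hle : ((d + 1 : ℕ) : Cardinal) ≤ Module.rank L' D := by
      have := Order.succ_le_of_lt hlt
      rw [Cardinal.succ_natCast] at this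
      exact_mod_cast this
    rw [Module.le_rank_iff] at hle
    obtain ⟨v, hv⟩ := hle
    letI : Module (L' ⊗[F] D) D := Module.compHom D (rho ι hsm).toRingHom
    haveI : SMulCommClass (L' ⊗[F] D) F D := ⟨fun r f x => by
      change rho ι hsm r (f • x) = f • rho ι hsm r x
      rw [← algebraMap_smul L' f x, map_smul, algebraMap_smul]⟩
    refine hmat (Fin (d+1)) (by simp) (PI.matrix w d v (hv.restrict_scalars' F)
      (fun y => density ι hsm hmax v hv y) (PI.tensor w d L' h))
  have hfin : Module.Finite L' D := by
    rw [← Module.rank_lt_aleph0_iff]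
    exact hrank.trans_lt (Cardinal.natCast_lt_aleph0)
  have h1 : Module.finrank L' D ≤ d := by
    rw [← Module.finrank_eq_rank] at hrank
    exact_mod_cast hrank
  have h2 := LinearMap.rank_le_of_injective (rho ι hsm).toLinearMap (rho_injective ι hcenter hsm)
  have h3 : Module.rank L' (Module.End L' D) = ((Module.finrank L' D * Module.finrank L' D : ℕ) : Cardinal) := by
    rw [← Module.finrank_eq_rank]
    exact congrArg _ (Module.finrank_linearMap L' L' D D)
  rw [h3, Module.rank_baseChange] at h2
  have h4 : Cardinal.lift (Module.rank F D) ≤ ((d ^ 2 : ℕ) : Cardinal) := by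
    refine h2.trans ?_
    rw [pow_two]
    exact_mod_cast Nat.mul_le_mul h1 h1
  simpa using h4

end WordAlg

namespace WordAlg
open Polynomial Matrix

section Minor

lemma exists_minor {K ι : Type*} [Field K] [Fintype ι] {N : ℕ} (x : Fin N → ι → K)
    (hx : LinearIndependent K x) : ∃ f : Fin N → ι, (Matrix.of fun i j => x i (f j)).det ≠ 0 := by
  classical
  let A : Matrix (Fin N) ι K := Matrix.of x
  have hr : A.rank = N := by simpa using LinearIndependent.rank_matrix (M := A) hx
  have hspan : Submodule.span K (Set.range A.col) = ⊤ := by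
    refine Submodule.eq_top_of_finrank_eq ?_
    rw [← Matrix.rank_eq_finrank_span_cols, hr]
    simp
  obtain ⟨κ, a, ha, hs, hli⟩ := exists_linearIndependent' K A.col
  rw [hspan] at hs
  let b := Module.Basis.mk hli hs.ge
  let e : κ ≃ Fin N := b.indexEquiv (Pi.basisFun K (Fin N))
  refine ⟨a ∘ e.symm, ?_⟩
  have : LinearIndependent K (Matrix.of fun i j => x i ((a ∘ e.symm) j)).col :=
    hli.comp e.symm e.symm.injective
  rw [Matrix.linearIndependent_cols_iff_isUnit, Matrix.isUnit_iff_isUnit_det] at this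
  exact this.ne_zero

lemma list_single_prod {K n : Type*} [Field K] [Fintype n] [DecidableEq n] (p : n) (l : List K) :
    (l.map (Matrix.single p p)).prod p p = l.prod := by
  induction l with
  | nil => simp
  | cons a l ih => simp [ih, Matrix.single_mul_apply_same]

lemma cap_single {K n : Type*} [Field K] [Fintype n] [DecidableEq n] {N : ℕ} (p : n)
    (x : Fin N → Matrix n n K) (P Q : Fin N → n) :
    cap x (fun j => Matrix.single p (P j) 1) (fun j => Matrix.single (Q j) p 1) p p =
      (Matrix.of fun i j => x i (P j) (Q j)).det := by
  rw [cap, Matrix.det_apply, Matrix.sum_apply]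
  refine Finset.sum_congr rfl fun σ _ => ?_
  rw [Units.smul_def, Units.smul_def, Matrix.smul_apply]
  congr 1
  have : (fun j => Matrix.single p (P j) (1 : K) * x (σ j) * Matrix.single (Q j) p 1) =
      (Matrix.single p p) ∘ (fun j => x (σ j) (P j) (Q j)) := by
    funext j
    simp [Matrix.single_mul_mul_single]
  rw [this, ← List.map_ofFn, list_single_prod, List.prod_ofFn]
  rfl

end Minor

section Trace
variable {F : Type*} [Field F]

/-- The underlying matrix. -/
def mt {R : Type*} [CommRing R] : SpecialLinearGroup (Fin 2) R →* Matrix (Fin 2) (Fin 2) R where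
  toFun A := A.1
  map_one' := rfl
  map_mul' _ _ := rfl

lemma mt_inv {R : Type*} [CommRing R] (A : SpecialLinearGroup (Fin 2) R) :
    mt A⁻¹ = (mt A).adjugate := rfl

lemma det_mt {R : Type*} [CommRing R] (A : SpecialLinearGroup (Fin 2) R) :
    (mt A).det = 1 := A.2

/-- Unipotent element. -/
noncomputable def su (z α : F) : SpecialLinearGroup (Fin 2) F[X] :=
  ⟨!![1 - C (α * z) * X, C α * X; - (C (α * z ^ 2) * X), 1 + C (α * z) * X], by
    rw [Matrix.det_fin_two_of]
    simp only [C_mul, C_pow]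
    ring⟩

lemma mt_su (z α : F) : mt (su z α) =
  !![1 - C (α * z) * X, C α * X; - (C (α * z ^ 2) * X), 1 + C (α * z) * X] := rfl

/-- `M` is the matrix of coefficients of degree `N`, which is maximal possible. -/
def Top (N : ℕ) (P : Matrix (Fin 2) (Fin 2) F[X]) (M : Matrix (Fin 2) (Fin 2) F) : Prop :=
  ∀ i j, (P i j).natDegree ≤ N ∧ (P i j).coeff N = M i j

lemma Top.mul {N N' : ℕ} {P P' : Matrix (Fin 2) (Fin 2) F[X]} {M M' : Matrix (Fin 2) (Fin 2) F}
    (h : Top N P M) (h' : Top N' P' M') : Top (N + N') (P * P') (M * M') := by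
  intro i j
  rw [Matrix.mul_apply, Matrix.mul_apply]
  constructor
  · refine natDegree_sum_le_of_forall_le _ _ fun k _ => ?_
    exact natDegree_mul_le_of_le (h i k).1 (h' k j).1
  · rw [finsetSum_coeff]
    refine Finset.sum_congr rfl fun k _ => ?_
    rw [coeff_mul_add_eq_of_natDegree_le (h i k).1 (h' k j).1, (h i k).2, (h' k j).2]

/-- Nilpotent matrix. -/
def nil (z : F) : Matrix (Fin 2) (Fin 2) F := !![-z, 1; -z^2, z]

/-- Rank one matrix. -/
def rk (x y : F) : Matrix (Fin 2) (Fin 2) F := !![-y, 1; -(x*y), x]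

lemma nil_mul_nil (x y : F) : nil x * nil y = (y - x) • rk x y := by
  ext i j
  fin_cases i <;> fin_cases j <;> simp [nil, rk] <;> ring

lemma rk_mul_rk (x y x' y' : F) : rk x y * rk x' y' = (x' - y) • rk x y' := by
  ext i j
  fin_cases i <;> fin_cases j <;> simp [rk] <;> ring

lemma lin_top (a c : F) : (C a + C c * X : F[X]).natDegree ≤ 1 ∧ (C a + C c * X : F[X]).coeff 1 = c := by
  constructor
  · compute_degree
  · simp [coeff_C]

lemma top_su (z α : F) : Top 1 (mt (su z α)) (α • nil z) := by
  intro i j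
  fin_cases i <;> fin_cases j
  · convert lin_top (1 : F) (-(α * z)) using 2 <;> simp [mt_su, nil] <;> ring_nf
  · convert lin_top (0 : F) α using 2 <;> simp [mt_su, nil]
  · convert lin_top (0 : F) (-(α * z ^ 2)) using 2 <;> simp [mt_su, nil]
  · convert lin_top (1 : F) (α * z) using 2 <;> simp [mt_su, nil]

lemma top_su_inv (z α : F) :
    Top 1 (mt (su z α)⁻¹)
      ((-α) • nil z) := by
  intro i j
  rw [mt_inv, mt_su, Matrix.adjugate_fin_two]
  fin_cases i <;> fin_cases j
  · convert lin_top (1 : F) (α * z) using 2 <;> simp [mt_su, nil]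
  · convert lin_top (0 : F) (-α) using 2 <;> simp [mt_su, nil]
  · convert lin_top (0 : F) (α * z ^ 2) using 2 <;> simp [mt_su, nil]
  · convert lin_top (1 : F) (-(α * z)) using 2 <;> simp [mt_su, nil] <;> ring_nf

variable {m : ℕ} (z : Fin m × Bool → F)

/-- The generators. -/
noncomputable def gen (α : F) (i : Fin m) : SpecialLinearGroup (Fin 2) F[X] :=
  su (z (i, true)) α * su (z (i, false)) α

/-- The letters. -/
noncomputable def letter (α : F) (l : Fin m × Bool) : SpecialLinearGroup (Fin 2) F[X] :=
  cond l.2 (gen z α l.1) (gen z α l.1)⁻¹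

/-- The inverse letter. -/
def bar (l : Fin m × Bool) : Fin m × Bool := (l.1, !l.2)

lemma top_letter (α : F) (l : Fin m × Bool) :
    Top 2 (mt (letter z α l)) ((α ^ 2 * (z (bar l) - z l)) • rk (z l) (z (bar l))) := by
  obtain ⟨i, b⟩ := l
  cases b
  · have := (top_su_inv (z (i, false)) α).mul (top_su_inv (z (i, true)) α)
    simp only [letter, gen, cond_false, _root_.mul_inv_rev, bar, Bool.not_false, map_mul]
    convert this using 1
    rw [Matrix.smul_mul, Matrix.mul_smul, nil_mul_nil, smul_smul, smul_smul]
    congr 1; ring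
  · have := (top_su (z (i, true)) α).mul (top_su (z (i, false)) α)
    simp only [letter, gen, cond_true, bar, Bool.not_true, map_mul]
    convert this using 1
    rw [Matrix.smul_mul, Matrix.mul_smul, nil_mul_nil, smul_smul, smul_smul]
    congr 1; ring

lemma chain (hz : Function.Injective z) : ∀ (L : List (Fin m × Bool)) (l : Fin m × Bool),
    FreeGroup.IsReduced (l :: L) → ∃ κ : F, κ ≠ 0 ∧ ∀ α,
      Top (2 * (L.length + 1)) (mt ((l :: L).map (letter z α)).prod)
        ((α ^ (2 * (L.length + 1)) * κ) • rk (z l) (z (bar ((l :: L).getLast (by simp))))) := by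
  have hbar : ∀ l : Fin m × Bool, bar l ≠ l := by
    rintro ⟨i, b⟩ h
    simp [bar] at h
  intro L
  induction L with
  | nil =>
    intro l _
    refine ⟨z (bar l) - z l, sub_ne_zero.mpr fun h => hbar l (hz h), fun α => ?_⟩
    simpa using top_letter z α l
  | cons l' L ih =>
    intro l hL
    rw [FreeGroup.isReduced_cons_cons] at hL
    obtain ⟨κ, hκ, h⟩ := ih l' hL.2
    refine ⟨(z (bar l) - z l) * (z l' - z (bar l)) * κ, mul_ne_zero (mul_ne_zero
      (sub_ne_zero.mpr fun h => hbar l (hz h)) (sub_ne_zero.mpr fun h => ?_)) hκ, fun α => ?_⟩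
    · have h1 := hz h
      subst h1
      have := hL.1 rfl
      simp [bar] at this
    · have := (top_letter z α l).mul (h α)
      rw [Matrix.smul_mul, Matrix.mul_smul, rk_mul_rk, smul_smul, smul_smul] at this
      rw [List.map_cons, List.prod_cons, List.length_cons, List.getLast_cons (by simp),
        map_mul]
      convert this using 1
      · ring
      · congr 1; ring

lemma trace_word (hz : Function.Injective z) (w : FreeGroup (Fin m)) (hw : w ≠ 1) :
    ∃ (N : ℕ) (κ : F), 0 < N ∧ κ ≠ 0 ∧ ∀ α,
      (Matrix.trace (mt (FreeGroup.lift (gen z α) w))).coeff N = α ^ N * κ := by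
  set L := FreeGroup.reduceCyclically w.toWord with hL
  have hcyc : FreeGroup.IsCyclicallyReduced L :=
    FreeGroup.reduceCyclically.isCyclicallyReduced FreeGroup.isReduced_toWord
  have hconj := FreeGroup.reduceCyclically.conj_conjugator_reduceCyclically w.toWord
  set c := FreeGroup.reduceCyclically.conjugator w.toWord
  have hw' : w = FreeGroup.mk c * FreeGroup.mk L * (FreeGroup.mk c)⁻¹ := by
    rw [FreeGroup.inv_mk, FreeGroup.mul_mk, FreeGroup.mul_mk, hconj, FreeGroup.mk_toWord]
  have htr : ∀ α, Matrix.trace (mt (FreeGroup.lift (gen z α) w)) =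
      Matrix.trace (mt (L.map (letter z α)).prod) := by
    intro α
    have h1 : FreeGroup.lift (gen z α) (FreeGroup.mk L) = (L.map (letter z α)).prod :=
      FreeGroup.lift_mk
    have h2 : FreeGroup.lift (gen z α) w = FreeGroup.lift (gen z α) (FreeGroup.mk c) *
        (L.map (letter z α)).prod * (FreeGroup.lift (gen z α) (FreeGroup.mk c))⁻¹ := by
      rw [← h1, ← map_inv, ← map_mul, ← map_mul, ← hw']
    rw [h2, map_mul, Matrix.trace_mul_comm, ← map_mul, inv_mul_cancel_left]
  match L, hcyc, hw', htr with
  | [], _, hw', _ =>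
    exfalso
    apply hw
    rw [hw', show FreeGroup.mk ([] : List (Fin m × Bool)) = 1 from rfl, mul_one, mul_inv_cancel]
  | l :: L, hcyc, _, htr =>
    obtain ⟨κ, hκ, h⟩ := chain z hz L l hcyc.isReduced
    refine ⟨2 * (L.length + 1), κ * (z l - z (bar ((l :: L).getLast (by simp)))), by positivity,
      mul_ne_zero hκ (sub_ne_zero.mpr fun h => ?_), fun α => ?_⟩
    · have h1 := hz h
      have h2 := hcyc.2 ((l :: L).getLast (by simp)) (by rw [List.getLast?_eq_getLast_of_ne_nil (by simp)]; rfl) l rfl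
        (by rw [congrArg Prod.fst h1]; rfl)
      have h3 := congrArg Prod.snd h1
      simp only [bar] at h3
      rw [h2] at h3
      simp at h3
    · rw [htr, Matrix.trace_fin_two, coeff_add, (h α 0 0).2, (h α 1 1).2]
      simp [rk]
      ring

end Trace
end WordAlg

namespace WordAlg
open Polynomial Matrix

section Poly
variable {K : Type*} [Field K]

/-- The characteristic polynomial of an element of `SL₂` with trace `t`. -/
noncomputable def chi (t : K) : K[X] := X ^ 2 - C t * X + 1

lemma chi_natDegree (t : K) : (chi t).natDegree = 2 := by
  unfold chi; compute_degree!

lemma chi_monic (t : K) : (chi t).Monic := by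
  unfold chi; monicity!

lemma chi_coprime {s t : K} (h : s ≠ t) : IsCoprime (chi s) (chi t) := by
  have h' : t - s ≠ 0 := sub_ne_zero.mpr h.symm
  have hc : C (t - s) * C (t - s)⁻¹ = (1 : K[X]) := by rw [← C_mul, mul_inv_cancel₀ h', C_1]
  refine ⟨1 - (X - C s) * C (t - s)⁻¹ * 1, (X - C s) * C (t - s)⁻¹, ?_⟩
  have : chi s - chi t = C (t - s) * X := by simp [chi]; ring
  have h2 : chi s = 1 + X * (X - C s) := by simp [chi]; ring
  linear_combination (1 : K[X]) * h2 - (X - C s) * C (t - s)⁻¹ * this - (X - C s) * X * hc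

lemma chi_coprime_lin {t : K} (h : t ≠ 2) : IsCoprime (chi t) (X - C 1) := by
  have h' : 2 - t ≠ 0 := sub_ne_zero.mpr h.symm
  have hc : C (2 - t) * C (2 - t)⁻¹ = (1 : K[X]) := by rw [← C_mul, mul_inv_cancel₀ h', C_1]
  refine ⟨C (2 - t)⁻¹, - C (2 - t)⁻¹ * (X + C (1 - t)), ?_⟩
  have : chi t = C (2 - t) + (X - C 1) * (X + C (1 - t)) := by
    have : (C 2 : K[X]) = 2 := rfl
    simp [chi, this]; ring
  linear_combination C (2 - t)⁻¹ * this + hc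

lemma chi_dvd (W : Matrix (Fin 2) (Fin 2) K) (hdet : W.det = 1) (ht : W.trace ^ 2 ≠ 4) (p : K[X])
    (hp : aeval W p = 0) : chi W.trace ∣ p := by
  have hchi : aeval W (chi W.trace) = 0 := by
    have := Matrix.aeval_self_charpoly W
    rwa [Matrix.charpoly_fin_two, hdet, C_1] at this
  rw [← modByMonic_eq_zero_iff_dvd (chi_monic _)]
  set q := p %ₘ chi W.trace with hq
  have hq0 : aeval W q = 0 := by
    have := modByMonic_add_div p (chi W.trace)
    rw [← hp, ← this, map_add, map_mul, hchi, zero_mul, add_zero]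
  have hdeg : q.natDegree ≤ 1 := by
    have := natDegree_modByMonic_lt p (chi_monic W.trace) (by
      intro h
      have := chi_natDegree W.trace
      rw [h] at this
      simp at this)
    rw [chi_natDegree] at this
    exact Nat.le_of_lt_succ this
  obtain ⟨a, b, hab⟩ := exists_eq_X_add_C_of_natDegree_le_one hdeg
  rw [hab] at hq0 ⊢
  simp only [map_add, map_mul, aeval_C, aeval_X, Algebra.algebraMap_eq_smul_one, smul_mul_assoc, one_mul] at hq0
  have e00 := congrFun (congrFun hq0 0) 0
  have e01 := congrFun (congrFun hq0 0) 1
  have e10 := congrFun (congrFun hq0 1) 0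
  have e11 := congrFun (congrFun hq0 1) 1
  simp at e00 e01 e10 e11
  by_cases ha : a = 0
  · subst ha
    simp at e00
    simp [e00]
  · exfalso
    apply ht
    have h01 : W 0 1 = 0 := by tauto
    have h10 : W 1 0 = 0 := by tauto
    have h : W 0 0 = W 1 1 := mul_left_cancel₀ ha (by linear_combination e00 - e11)
    rw [Matrix.det_fin_two, h01, h] at hdet
    rw [Matrix.trace_fin_two, h]
    linear_combination 4 * hdet

lemma deg_bound {r e : ℕ} (he : e < 2) (t : Fin r → K) (ht : Function.Injective t)
    (ht2 : ∀ j, t j ≠ 2) (p : K[X]) (hp : p ≠ 0) (h : ∀ j, chi (t j) ∣ p)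
    (h1 : 0 < e → p.eval 1 = 0) : 2 * r + e ≤ p.natDegree := by
  have hA : (∏ j, chi (t j)) ∣ p := by
    refine Finset.prod_dvd_of_coprime (fun i _ j _ hij => chi_coprime (ht.ne hij)) fun j _ => h j
  have hB : (X - C 1) ^ e ∣ p := by
    rcases Nat.eq_zero_or_pos e with rfl | h0
    · simp
    · obtain rfl : e = 1 := by omega
      rw [pow_one, dvd_iff_isRoot]
      exact h1 h0
  have hAB : (∏ j, chi (t j)) * (X - C 1) ^ e ∣ p :=
    IsCoprime.mul_dvd (IsCoprime.pow_right (IsCoprime.prod_left fun j _ => chi_coprime_lin (ht2 j))) hA hB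
  have := natDegree_le_of_dvd hAB hp
  rw [Monic.natDegree_mul (monic_prod_of_monic _ _ fun j _ => chi_monic _) ((monic_X_sub_C 1).pow e),
    natDegree_prod_of_monic _ _ fun j _ => chi_monic _, natDegree_pow, natDegree_X_sub_C] at this
  simp [chi_natDegree] at this
  omega

end Poly

section Blocks

/-- From power series over matrices to matrices over power series. -/
noncomputable def psm {n F : Type*} [Fintype n] [DecidableEq n] [Field F] :
    PowerSeries (Matrix n n F) →+* Matrix n n (PowerSeries F) where
  toFun M := Matrix.of fun i j => PowerSeries.mk fun l => PowerSeries.coeff l M i j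
  map_zero' := by ext; simp
  map_one' := by
    ext i j l
    simp only [of_apply, PowerSeries.coeff_mk, PowerSeries.coeff_one, Matrix.one_apply]
    split_ifs <;> simp_all [PowerSeries.coeff_one, Matrix.one_apply]
  map_add' _ _ := by ext; simp
  map_mul' M M' := by
    ext i j l
    simp only [of_apply, PowerSeries.coeff_mk, PowerSeries.coeff_mul, Matrix.mul_apply,
      Matrix.sum_apply, map_sum]
    exact Finset.sum_comm

lemma psm_C {n F : Type*} [Fintype n] [DecidableEq n] [Field F] (M : Matrix n n F) :
    psm (PowerSeries.C M) = M.map PowerSeries.C := by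
  ext i j l
  simp [psm, PowerSeries.coeff_C]
  split_ifs <;> simp

lemma psm_X {n F : Type*} [Fintype n] [DecidableEq n] [Field F] :
    psm (PowerSeries.X : PowerSeries (Matrix n n F)) = Matrix.scalar n PowerSeries.X := by
  ext i j l
  simp [psm, PowerSeries.coeff_X, Matrix.diagonal_apply]
  split_ifs <;> simp_all [PowerSeries.coeff_X, Matrix.one_apply]

variable (K : Type*) [Field K] (r e : ℕ)

/-- Block diagonal matrices. -/
noncomputable def blk : ((Fin r → Matrix (Fin 2) (Fin 2) K) × Matrix (Fin e) (Fin e) K) →ₐ[K]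
    Matrix (Fin 2 × Fin r ⊕ Fin e) (Fin 2 × Fin r ⊕ Fin e) K :=
  AlgHom.ofLinearMap
    { toFun := fun g => Matrix.fromBlocks (Matrix.blockDiagonal g.1) 0 0 g.2
      map_add' := fun x y => by
        simp [Matrix.fromBlocks_add, Matrix.blockDiagonal_add]
      map_smul' := fun c x => by
        simp [Matrix.fromBlocks_smul, Matrix.blockDiagonal_smul] }
    (by simp [Matrix.blockDiagonal_one])
    (fun x y => by simp [Matrix.fromBlocks_multiply, Matrix.blockDiagonal_mul, Pi.mul_def])

lemma blk_apply (g) : blk K r e g = Matrix.fromBlocks (Matrix.blockDiagonal g.1) 0 0 g.2 := rfl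

lemma blk_injective : Function.Injective (blk K r e) := by
  intro g g' h
  rw [blk_apply, blk_apply, Matrix.fromBlocks_inj] at h
  exact Prod.ext (Matrix.blockDiagonal_injective h.1) h.2.2.2


end Blocks

section Core
variable {K : Type*} [Field K]

lemma exists_poly {n : Type*} [Fintype n] [DecidableEq n] (p0 : n) (d : ℕ) (W : Matrix n n K)
    (hW : ∀ P Q : Fin (d + 1) → n, cap (fun i : Fin (d + 1) => W ^ (i : ℕ))
      (fun j => Matrix.single p0 (P j) 1) (fun j => Matrix.single (Q j) p0 1) = 0) :
    ∃ p : K[X], p ≠ 0 ∧ p.natDegree ≤ d ∧ aeval W p = 0 := by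
  let x : Fin (d + 1) → n × n → K := fun i q => (W ^ (i : ℕ)) q.1 q.2
  have hx : ¬ LinearIndependent K x := by
    intro h
    obtain ⟨f, hf⟩ := exists_minor x h
    apply hf
    have := congrFun (congrFun (hW (fun j => (f j).1) (fun j => (f j).2)) p0) p0
    rwa [cap_single] at this
  rw [Fintype.not_linearIndependent_iff] at hx
  obtain ⟨g, hg, i, hi⟩ := hx
  refine ⟨∑ i, C (g i) * X ^ (i : ℕ), ?_, ?_, ?_⟩
  · intro h
    apply hi
    have := congrArg (fun q => coeff q (i : ℕ)) h
    simpa [finsetSum_coeff, coeff_X_pow, ← Fin.ext_iff] using this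
  · refine natDegree_sum_le_of_forall_le _ _ fun k _ => ?_
    refine (natDegree_C_mul_X_pow_le _ _).trans (by omega)
  · ext a b
    have := congrFun hg (a, b)
    simpa [Matrix.sum_apply, Algebra.algebraMap_eq_smul_one, x] using this

variable (F : Type*) [Field F] (r e : ℕ)

/-- The field of fractions. -/
abbrev FK := FractionRing (PowerSeries F)

/-- The index type. -/
abbrev Ix := Fin 2 × Fin r ⊕ Fin e

/-- The embedding of polynomials. -/
noncomputable def jj : F[X] →+* FK F :=
  (algebraMap (PowerSeries F) (FK F)).comp Polynomial.coeToPowerSeries.ringHom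

lemma jj_injective : Function.Injective (jj F) :=
  (IsFractionRing.injective (PowerSeries F) (FK F)).comp (Polynomial.coe_injective F)

/-- Auxiliary homomorphism. -/
noncomputable def preth : (Fin r → SpecialLinearGroup (Fin 2) F[X]) →*
    ((Fin r → Matrix (Fin 2) (Fin 2) (FK F)) × Matrix (Fin e) (Fin e) (FK F)) where
  toFun g := (fun k => (jj F).mapMatrix (mt (g k)), 1)
  map_one' := by
    refine Prod.ext ?_ rfl
    funext k
    simp only [Pi.one_apply, map_one, Prod.fst_one]
  map_mul' g g' := by
    refine Prod.ext ?_ (by simp)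
    funext k
    simp only [Pi.mul_apply, map_mul, Prod.fst_mul]

/-- Auxiliary homomorphism. -/
noncomputable def theta : (Fin r → SpecialLinearGroup (Fin 2) F[X]) →*
    (Matrix (Ix r e) (Ix r e) (FK F))ˣ :=
  ((blk (FK F) r e : _ →* _).comp (preth F r e)).toHomUnits

lemma theta_val (g) : ((theta F r e g : (Matrix (Ix r e) (Ix r e) (FK F))ˣ) : Matrix _ _ _) =
    blk (FK F) r e (fun k => (jj F).mapMatrix (mt (g k)), 1) := rfl

/-- Auxiliary homomorphism. -/
noncomputable def psi : PowerSeries (Matrix (Ix r e) (Ix r e) F) →+* Matrix (Ix r e) (Ix r e) (FK F) :=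
  (algebraMap (PowerSeries F) (FK F)).mapMatrix.comp psm

/-- The block diagonal nilpotent matrices. -/
noncomputable def bz (α : Fin r → F) (z : F) : Matrix (Ix r e) (Ix r e) F :=
  blk F r e (fun k => α k • nil z, 0)

lemma psi_pu (α : Fin r → F) (z : F) :
    Units.map (psi F r e : _ →* _) (pu (bz F r e α z)) = theta F r e (fun k => su z (α k)) := by
  ext1
  rw [theta_val, blk_apply]
  have : ((Units.map (psi F r e : _ →* _) (pu (bz F r e α z)) : (Matrix (Ix r e) (Ix r e) (FK F))ˣ) :
      Matrix (Ix r e) (Ix r e) (FK F)) = (algebraMap (PowerSeries F) (FK F)).mapMatrix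
        (1 + (bz F r e α z).map PowerSeries.C * Matrix.scalar _ PowerSeries.X) := by
    simp only [Units.coe_map, pu_val, MonoidHom.coe_coe, psi, RingHom.comp_apply]
    rw [map_add, map_one, map_mul, psm_C, psm_X]
  rw [this, bz, blk_apply]
  ext a b
  rcases a with ⟨i, k⟩ | a <;> rcases b with ⟨j, l⟩ | b
  · by_cases hkl : k = l
    · subst hkl
      fin_cases i <;> fin_cases j <;>
        simp [Matrix.blockDiagonal_apply, Matrix.one_apply, nil, mt_su, jj]
      ring
    · simp [Matrix.blockDiagonal_apply, Matrix.one_apply, hkl]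
  · simp
  · simp
  · by_cases hab : a = b <;> simp [Matrix.one_apply, hab]

variable {m : ℕ} (w : FreeGroup (Fin m))

lemma psi_wv (α : Fin r → F) (z : Fin m × Bool → F) :
    psi F r e (wv w (fun i => bz F r e α (z (i, true))) (fun i => bz F r e α (z (i, false))) :
      (PowerSeries (Matrix (Ix r e) (Ix r e) F))ˣ) =
    blk (FK F) r e (fun k => (jj F).mapMatrix (mt (FreeGroup.lift (gen z (α k)) w)), 1) := by
  rw [← theta_val F r e (fun k => FreeGroup.lift (gen z (α k)) w)]
  have h1 : (fun k => FreeGroup.lift (gen z (α k)) w) =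
      FreeGroup.lift (fun i k => gen z (α k) i) w := by
    funext k
    exact (map_lift w (Pi.evalMonoidHom _ k) (fun i k => gen z (α k) i)).symm
  have h2 : Units.map (psi F r e : _ →* _) (wv w (fun i => bz F r e α (z (i, true)))
      (fun i => bz F r e α (z (i, false)))) = theta F r e (fun k => FreeGroup.lift (gen z (α k)) w) := by
    rw [h1, map_lift, wv, map_lift]
    congr 2
    funext i
    rw [Function.comp_apply, Function.comp_apply, map_mul, psi_pu, psi_pu, ← map_mul]
    rfl
  rw [← h2]
  rfl

lemma exists_roots [Infinite F] {N : ℕ} (hN : 0 < N) :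
    ∃ α : Fin r → F, (∀ k, α k ≠ 0) ∧ Function.Injective fun k => α k ^ N := by
  have hinf : (Set.range fun x : F => x ^ N).Infinite := by
    classical
    intro hfin
    have := hfin.preimage' (f := fun x : F => x ^ N) (fun b _ => by
      refine (nthRoots N b).toFinset.finite_toSet.subset fun x hx => ?_
      simpa [mem_nthRoots hN] using hx)
    rw [Set.preimage_range] at this
    exact Set.infinite_univ this
  have hinf2 := hinf.sdiff (Set.finite_singleton (0 : F))
  let E := hinf2.natEmbedding
  have hE : ∀ k : Fin r, ∃ x : F, x ^ N = (E k : F) := fun k => (E k).2.1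
  choose α hα using hE
  refine ⟨α, fun k h0 => ?_, fun k l h => ?_⟩
  · apply (E k).2.2
    rw [← hα, h0, zero_pow hN.ne']
    rfl
  · simp only [hα] at h
    exact Fin.ext (E.injective (Subtype.ext h))

theorem not_PI [Infinite F] (hw : w ≠ 1) (d : ℕ) (n : Type) [Fintype n] [DecidableEq n]
    (hn : Fintype.card n = d + 1) : ¬ PI w d (Matrix n n F) := by
  intro h
  obtain ⟨r, e, hre, he⟩ : ∃ r e, 2 * r + e = d + 1 ∧ e < 2 :=
    ⟨(d + 1) / 2, (d + 1) % 2, by omega, by omega⟩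
  have hcard : Fintype.card n = Fintype.card (Ix r e) := by simp [hn, ← hre]
  let e0 : n ≃ Ix r e := Fintype.equivOfCardEq hcard
  have h0 : PI w d (Matrix (Ix r e) (Ix r e) F) :=
    PI.of_surjective w d (Matrix.reindexAlgEquiv F F e0).toRingEquiv.toRingHom
      (Matrix.reindexAlgEquiv F F e0).surjective h
  have hz : ∃ z : Fin m × Bool → F, Function.Injective z :=
    ⟨fun q => Infinite.natEmbedding F (Fintype.equivFin _ q),
      (Infinite.natEmbedding F).injective.comp (Fin.val_injective.comp (Equiv.injective _))⟩
  obtain ⟨z, hz⟩ := hz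
  obtain ⟨N, κ, hN, hκ, htr⟩ := trace_word z hz w hw
  obtain ⟨α, hα0, hα⟩ := exists_roots F r hN
  have hne : Nonempty (Ix r e) := by
    rw [← Fintype.card_pos_iff, ← hcard, hn]; omega
  obtain ⟨p0⟩ := hne
  obtain ⟨p, hp, hdeg, hpW⟩ := exists_poly p0 d
      (psi F r e (wv w (fun i => bz F r e α (z (i, true))) (fun i => bz F r e α (z (i, false))) :
      (PowerSeries (Matrix (Ix r e) (Ix r e) F))ˣ)) (by
    intro P Q
    have := congrArg (psi F r e) (h0 (fun i => bz F r e α (z (i, true)))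
      (fun i => bz F r e α (z (i, false))) (fun j => Matrix.single p0 (P j) 1)
      (fun j => Matrix.single (Q j) p0 1))
    rw [ex, map_cap, map_zero] at this
    convert this using 2
    · funext i; simp
    · funext i
      simp [psi, psm_C]
    · funext i
      simp [psi, psm_C])
  rw [psi_wv, aeval_algHom_apply] at hpW
  have hp0 := blk_injective (FK F) r e (hpW.trans (map_zero _).symm)
  have hp1 := congrArg (AlgHom.fst (FK F) _ _) hp0
  have hp2 := congrArg (AlgHom.snd (FK F) _ _) hp0
  rw [← aeval_algHom_apply, map_zero] at hp1 hp2
  set T : Fin r → F[X] := fun k => trace (mt (FreeGroup.lift (gen z (α k)) w)) with hT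
  have htrace : ∀ k, trace ((jj F).mapMatrix (mt (FreeGroup.lift (gen z (α k)) w))) = jj F (T k) := by
    intro k
    simp [hT, Matrix.trace_fin_two]
  have hconst : ∀ (k) (c : F), T k ≠ C c := by
    intro k c hc
    have := htr (α k)
    change (T k).coeff N = _ at this
    rw [hc, coeff_C, if_neg hN.ne'] at this
    exact mul_ne_zero (pow_ne_zero _ (hα0 k)) hκ this.symm
  have hj2 : ∀ c : ℤ, jj F (C (c : F)) = c := by
    intro c; simp
  have hc2 : ∀ (k) (c : ℤ), jj F (T k) ≠ c := by
    intro k c hc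
    rw [← hj2] at hc
    exact hconst k _ (jj_injective F hc)
  have hfin := deg_bound he (fun k => jj F (T k)) (by
    intro k l hkl
    have h1 := jj_injective F hkl
    have h2 := congrArg (fun q => coeff q N) h1
    simp only [hT, htr] at h2
    exact hα (mul_right_cancel₀ hκ h2)) (fun k hk => hc2 k 2 (by exact_mod_cast hk)) p hp (by
      intro k
      rw [← htrace]
      refine chi_dvd _ ?_ ?_ p ?_
      · rw [← RingHom.map_det, det_mt, map_one]
      · rw [htrace]
        intro h4
        have : (jj F (T k) - 2) * (jj F (T k) + 2) = 0 := by linear_combination h4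
        rcases mul_eq_zero.mp this with h5 | h5
        · exact hc2 k 2 (by push_cast; linear_combination h5)
        · exact hc2 k (-2) (by push_cast; linear_combination h5)
      · have := congrArg (Pi.evalAlgHom (FK F) _ k) hp1
        rw [← aeval_algHom_apply, map_zero] at this
        exact this) (by
      intro he0
      have h1 : aeval (algebraMap (FK F) (Matrix (Fin e) (Fin e) (FK F)) 1) p = 0 := by
        rw [map_one]; exact hp2
      rw [aeval_algebraMap_apply, Algebra.algebraMap_eq_smul_one] at h1
      have := congrFun (congrFun h1 ⟨0, he0⟩) ⟨0, he0⟩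
      simpa using this)
  omega

end Core
end WordAlg


/-- Let `D` be a division ring whose center `F` is infinite, let `w(x_1,…,x_m)` be a
non-trivial group word, and let `d > 0`. If for all invertible `a_1,…,a_m ∈ D` the
value `w(a_1,…,a_m)` is algebraic over `F` of degree at most `d`, then `dim_F D ≤ d²`. -/
theorem dim_le_sq_of_word_algebraic_bounded
    {F D : Type*} [Field F] [Infinite F] [DivisionRing D] [Algebra F D]
    (hcenter : Set.range (algebraMap F D) = Set.center D)
    {m : ℕ} (w : FreeGroup (Fin m)) (hw : w ≠ 1)
    (d : ℕ) (hd : 0 < d)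
    (halg : ∀ a : Fin m → Dˣ,
      ∃ p : Polynomial F, p ≠ 0 ∧ p.natDegree ≤ d ∧
        Polynomial.aeval ((FreeGroup.lift a w : Dˣ) : D) p = 0) :
    Module.rank F D ≤ (d ^ 2 : ℕ) := by
  exact WordAlg.main_of_matrix hcenter w d (WordAlg.PI.of_alg w d halg)
    (fun n _ _ hn => WordAlg.not_PI F w hw d n hn)
end
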